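/- arXiv:1711.06539 — 4 statements merged into one kernel-verified Lean document; each statement's English description precedes it below -/
import Mathlib

section
/- Let f : 𝔹ⁿ → 𝔹ᴺ be holomorphic and minimal, i.e., the image of f is not contained in any proper affine subspace of ℂᴺ. Then H_f = {ψ ∈ Aut(𝔹ᴺ) : ψ ∘ f = f} consists only of the identity. -/
noncomputable section
open Metric Set

/-- An automorphism of the unit ball of `EuclideanSpace ℂ ι`: a holomorphic self-map of the
ball with a holomorphic inverse. -/
def IsBallAut {ι : Type} [Fintype ι] (ψ : EuclideanSpace ℂ ι → EuclideanSpace ℂ ι) : Prop :=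
  DifferentiableOn ℂ ψ (ball (0 : EuclideanSpace ℂ ι) 1) ∧
    MapsTo ψ (ball (0 : EuclideanSpace ℂ ι) 1) (ball (0 : EuclideanSpace ℂ ι) 1) ∧
    ∃ φ : EuclideanSpace ℂ ι → EuclideanSpace ℂ ι,
      DifferentiableOn ℂ φ (ball (0 : EuclideanSpace ℂ ι) 1) ∧
      MapsTo φ (ball (0 : EuclideanSpace ℂ ι) 1) (ball (0 : EuclideanSpace ℂ ι) 1) ∧
      (∀ z ∈ ball (0 : EuclideanSpace ℂ ι) 1, φ (ψ z) = z) ∧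
      (∀ z ∈ ball (0 : EuclideanSpace ℂ ι) 1, ψ (φ z) = z)

/-- Disc Moebius map. -/
def mobT (a z : ℂ) : ℂ := (z - a) / (1 - (starRingEnd ℂ) a * z)

lemma mobT_den {a z : ℂ} (ha : ‖a‖ < 1) (hz : ‖z‖ < 1) : 1 - (starRingEnd ℂ) a * z ≠ 0 := by
  intro h
  have h1 : (starRingEnd ℂ) a * z = 1 := (sub_eq_zero.mp h).symm
  have h2 : ‖a‖ * ‖z‖ = 1 := by
    have := congrArg norm h1
    simpa using this
  nlinarith [norm_nonneg a, norm_nonneg z]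

lemma mobT_norm {a z : ℂ} (ha : ‖a‖ < 1) (hz : ‖z‖ < 1) : ‖mobT a z‖ < 1 := by
  have hd := mobT_den ha hz
  unfold mobT
  rw [norm_div, div_lt_one (norm_pos_iff.mpr hd)]
  have e : ‖1 - (starRingEnd ℂ) a * z‖ ^ 2 - ‖z - a‖ ^ 2 = (1 - ‖a‖ ^ 2) * (1 - ‖z‖ ^ 2) := by
    simp only [← Complex.normSq_eq_norm_sq, Complex.normSq_apply]
    simp
    ring
  have p : 0 < (1 - ‖a‖ ^ 2) * (1 - ‖z‖ ^ 2) := by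
    apply mul_pos <;> nlinarith [norm_nonneg a, norm_nonneg z]
  exact lt_of_pow_lt_pow_left₀ 2 (norm_nonneg _) (by linarith)

lemma mobT_inv {a z : ℂ} (ha : ‖a‖ < 1) (hz : ‖z‖ < 1) : mobT (-a) (mobT a z) = z := by
  have hd := mobT_den ha hz
  have ha' : 1 - (starRingEnd ℂ) a * a ≠ 0 := mobT_den ha ha
  have hd2 : 1 - (starRingEnd ℂ) (-a) * mobT a z ≠ 0 :=
    mobT_den (by simpa using ha) (mobT_norm ha hz)
  unfold mobT at *
  rw [div_eq_iff hd2]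
  simp only [map_neg]
  have e : (z - a) / (1 - (starRingEnd ℂ) a * z) * (1 - (starRingEnd ℂ) a * z) = z - a :=
    div_mul_cancel₀ _ hd
  linear_combination e

lemma mobT_diff {a : ℂ} (ha : ‖a‖ < 1) : DifferentiableOn ℂ (mobT a) (ball 0 1) := by
  intro z hz
  have hz' : ‖z‖ < 1 := by simpa using hz
  unfold mobT
  have hd := mobT_den ha hz'
  apply DifferentiableAt.differentiableWithinAt
  exact DifferentiableAt.div (by fun_prop) (by fun_prop) hd

lemma disc_two_fixed (h : ℂ → ℂ) (hd : DifferentiableOn ℂ h (ball 0 1))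
    (hm : MapsTo h (ball 0 1) (ball 0 1)) {a b : ℂ} (ha : ‖a‖ < 1) (hb : ‖b‖ < 1) (hab : a ≠ b)
    (hfa : h a = a) (hfb : h b = b) : ∀ z : ℂ, ‖z‖ < 1 → h z = z := by
  have ha' : ‖-a‖ < 1 := by simpa using ha
  have hmT : ∀ {c : ℂ}, ‖c‖ < 1 → MapsTo (mobT c) (ball 0 1) (ball 0 1) := by
    intro c hc z hz
    simpa using mobT_norm hc (by simpa using hz)
  set k : ℂ → ℂ := mobT a ∘ h ∘ mobT (-a) with hk
  have hkd : DifferentiableOn ℂ k (ball 0 1) :=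
    (mobT_diff ha).comp (hd.comp (mobT_diff ha') (hmT ha')) (hm.comp (hmT ha'))
  have hkm : MapsTo k (ball 0 1) (ball 0 1) := (hmT ha).comp (hm.comp (hmT ha'))
  have hk0 : k 0 = 0 := by simp [hk, mobT, hfa]
  set b' := mobT a b with hb'
  have hb'n : ‖b'‖ < 1 := mobT_norm ha hb
  have hb'0 : b' ≠ 0 := by
    intro h0
    have h1 := mobT_inv ha hb
    rw [← hb', h0] at h1
    simp [mobT] at h1
    exact hab h1
  have hkb : k b' = b' := by
    simp only [hk, Function.comp, hb']
    rw [mobT_inv ha hb, hfb]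
  have hsl : dslope k 0 b' = 1 := by
    rw [dslope_of_ne _ hb'0, slope_def_field, hkb, hk0]
    simp [hb'0]
  have key := Complex.affine_of_mapsTo_ball_of_norm_dslope_eq_div (f := k) (c := 0) (R₁ := 1)
    (R₂ := 1) (z₀ := b') hkd
    (by rw [hk0]; exact hkm.mono_right ball_subset_closedBall) (by simpa using hb'n)
    (by rw [hsl]; simp)
  intro z hz
  have hTz := mobT_norm ha hz
  have h1 : k (mobT a z) = mobT a z := by
    have := key (show mobT a z ∈ ball 0 1 by simpa using hTz)
    simpa [hsl, hk0] using this
  simp only [hk, Function.comp] at h1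
  rw [mobT_inv ha hz] at h1
  have hhz : ‖h z‖ < 1 := by simpa using hm (show z ∈ ball 0 1 by simpa using hz)
  have h2 := congrArg (mobT (-a)) h1
  rwa [mobT_inv ha hz, mobT_inv ha hhz] at h2

section ip
variable {E : Type*} [NormedAddCommGroup E] [InnerProductSpace ℂ E]

lemma ip_identity (u c w : E) (r : ℝ) (hu : ‖u‖ = 1) (huc : inner ℂ u c = 0)
    (hr : r ^ 2 = 1 - ‖c‖ ^ 2) :
    ‖1 - inner ℂ c w‖ ^ 2 = r ^ 2 * (1 - ‖w‖ ^ 2) + r ^ 2 * ‖inner ℂ u w‖ ^ 2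
      + r ^ 2 * ‖w - inner ℂ u w • u - c‖ ^ 2
      + ‖inner ℂ c (w - inner ℂ u w • u - c)‖ ^ 2 := by
  set β : ℂ := inner ℂ u w with hβ
  set d := w - β • u - c with hd
  have hcu : inner ℂ c u = 0 := by rw [← inner_conj_symm, huc]; simp
  have huu : inner ℂ u u = 1 := by rw [inner_self_eq_norm_sq_to_K, hu]; simp
  have hcc : inner ℂ c c = ((‖c‖ ^ 2 : ℝ) : ℂ) := by rw [inner_self_eq_norm_sq_to_K]; simp
  have hud : inner ℂ u d = 0 := by
    rw [hd, inner_sub_right, inner_sub_right, inner_smul_right, huu, huc, ← hβ]; ring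
  have hw : w = β • u + (c + d) := by rw [hd]; abel
  set δ : ℂ := inner ℂ c d with hδ
  have hγ : inner ℂ c w = ((‖c‖ ^ 2 : ℝ) : ℂ) + δ := by
    rw [hw, inner_add_right, inner_add_right, inner_smul_right, hcu, hcc]; ring
  have hn1 : ‖w‖ ^ 2 = ‖β‖ ^ 2 + ‖c + d‖ ^ 2 := by
    have ho : inner ℂ (β • u) (c + d) = 0 := by
      rw [inner_smul_left, inner_add_right, huc, hud]; simp
    have := norm_add_sq_eq_norm_sq_add_norm_sq_of_inner_eq_zero (𝕜 := ℂ) (β • u) (c + d) ho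
    rw [← hw, norm_smul, hu] at this
    nlinarith
  have hn2 : ‖c + d‖ ^ 2 = ‖c‖ ^ 2 + 2 * δ.re + ‖d‖ ^ 2 := by
    rw [norm_add_sq (𝕜 := ℂ)]; rfl
  have hn3 : ‖1 - inner ℂ c w‖ ^ 2 = (r ^ 2 - δ.re) ^ 2 + δ.im ^ 2 := by
    rw [hγ, ← Complex.normSq_eq_norm_sq, Complex.normSq_apply, hr]
    simp [← Complex.ofReal_pow]
    ring
  have hn4 : ‖δ‖ ^ 2 = δ.re ^ 2 + δ.im ^ 2 := by
    rw [← Complex.normSq_eq_norm_sq, Complex.normSq_apply]; ring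
  have hc : ‖c‖ ^ 2 = 1 - r ^ 2 := by linarith
  rw [hn3, hn1, hn2, hn4, hc]
  ring

lemma line_fixed (ψ : E → E) (hd : DifferentiableOn ℂ ψ (ball 0 1))
    (hm : MapsTo ψ (ball 0 1) (ball 0 1)) {p v : E} (hv : v ≠ 0) (hp : p ∈ ball (0 : E) 1)
    (hpv : p + v ∈ ball (0 : E) 1) (hfp : ψ p = p) (hfq : ψ (p + v) = p + v) :
    ∀ t : ℂ, p + t • v ∈ ball (0 : E) 1 → ψ (p + t • v) = p + t • v := by
  have hvn : (‖v‖ : ℂ) ≠ 0 := by simpa using hv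
  set u : E := ((‖v‖ : ℂ)⁻¹) • v with hu_def
  have hvu : v = (‖v‖ : ℂ) • u := by rw [hu_def, smul_smul, mul_inv_cancel₀ hvn, one_smul]
  have hu : ‖u‖ = 1 := by
    rw [hu_def, norm_smul]; simp [hv]
  clear_value u
  have huu : inner ℂ u u = 1 := by rw [inner_self_eq_norm_sq_to_K, hu]; simp
  set c : E := p - inner ℂ u p • u with hc_def
  have huc : inner ℂ u c = 0 := by
    rw [hc_def, inner_sub_right, inner_smul_right, huu]; ring
  have hcu : inner ℂ c u = 0 := by rw [← inner_conj_symm, huc]; simp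
  have hcc : inner ℂ c c = ((‖c‖ ^ 2 : ℝ) : ℂ) := by rw [inner_self_eq_norm_sq_to_K]; simp
  -- norm on the line
  have hline : ∀ s : ℂ, ‖c + s • u‖ ^ 2 = ‖c‖ ^ 2 + ‖s‖ ^ 2 := by
    intro s
    have ho : inner ℂ c (s • u) = 0 := by rw [inner_smul_right, hcu]; simp
    have := norm_add_sq_eq_norm_sq_add_norm_sq_of_inner_eq_zero (𝕜 := ℂ) c (s • u) ho
    rw [norm_smul, hu] at this
    nlinarith
  have hball : ∀ x : E, x ∈ ball (0 : E) 1 ↔ ‖x‖ ^ 2 < 1 := by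
    intro x
    rw [mem_ball_zero_iff]
    constructor <;> intro h <;> nlinarith [norm_nonneg x]
  have hpc : p = c + (inner ℂ u p : ℂ) • u := by rw [hc_def]; abel
  have hc1 : ‖c‖ ^ 2 < 1 := by
    have h1 := (hball p).1 hp
    rw [hpc, hline] at h1
    nlinarith [sq_nonneg ‖(inner ℂ u p : ℂ)‖]
  set r : ℝ := Real.sqrt (1 - ‖c‖ ^ 2) with hr_def
  have hrpos : 0 < r := Real.sqrt_pos.mpr (by linarith)
  have hr : r ^ 2 = 1 - ‖c‖ ^ 2 := Real.sq_sqrt (by linarith)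
  have hrc : (r : ℂ) ≠ 0 := by exact_mod_cast hrpos.ne'
  have hrc2 : (r : ℂ) ^ 2 = 1 - ((‖c‖ ^ 2 : ℝ) : ℂ) := by
    rw [← Complex.ofReal_pow, hr]; push_cast; ring
  set φ : ℂ → E := fun ζ => c + ((r : ℂ) * ζ) • u with hφ
  have hφball : ∀ ζ, φ ζ ∈ ball (0 : E) 1 ↔ ‖ζ‖ < 1 := by
    intro ζ
    rw [hball, hφ]
    simp only
    rw [hline, norm_mul, Complex.norm_real, Real.norm_of_nonneg hrpos.le, mul_pow, hr]
    have : 0 < 1 - ‖c‖ ^ 2 := by linarith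
    constructor
    · intro h
      have h2 : (1 - ‖c‖ ^ 2) * (‖ζ‖ ^ 2 - 1) < 0 := by linarith
      have h3 : ‖ζ‖ ^ 2 - 1 < 0 := by
        by_contra h4
        push Not at h4
        nlinarith
      nlinarith [norm_nonneg ζ]
    · intro h
      have h3 : 0 < 1 - ‖ζ‖ ^ 2 := by nlinarith [norm_nonneg ζ]
      nlinarith [mul_pos this h3]
  have hφd : Differentiable ℂ φ := by
    rw [hφ]; fun_prop
  have hφm : MapsTo φ (ball 0 1) (ball 0 1) := by
    intro ζ hζ
    exact (hφball ζ).2 (by simpa using hζ)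
  -- retraction
  set ρ : E → ℂ := fun w => (r : ℂ) * inner ℂ u w / (1 - inner ℂ c w) with hρ
  have hden : ∀ w ∈ ball (0 : E) 1, r ^ 2 * ‖(inner ℂ u w : ℂ)‖ ^ 2 < ‖1 - inner ℂ c w‖ ^ 2 := by
    intro w hw
    have h1 := ip_identity u c w r hu huc hr
    have h2 : 0 < r ^ 2 * (1 - ‖w‖ ^ 2) :=
      mul_pos (by positivity) (by linarith [(hball w).1 hw])
    have h3 : 0 ≤ r ^ 2 * ‖w - (inner ℂ u w : ℂ) • u - c‖ ^ 2 := by positivity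
    have h4 := sq_nonneg ‖(inner ℂ c (w - (inner ℂ u w : ℂ) • u - c) : ℂ)‖
    linarith
  have hden0 : ∀ w ∈ ball (0 : E) 1, 1 - (inner ℂ c w : ℂ) ≠ 0 := by
    intro w hw h0
    have := hden w hw
    rw [h0] at this
    have : 0 ≤ r ^ 2 * ‖(inner ℂ u w : ℂ)‖ ^ 2 := by positivity
    simp at *
    linarith
  have hρm : MapsTo ρ (ball 0 1) (ball 0 1) := by
    intro w hw
    rw [mem_ball_zero_iff, hρ]
    simp only
    rw [norm_div, div_lt_one (norm_pos_iff.mpr (hden0 w hw))]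
    apply lt_of_pow_lt_pow_left₀ 2 (norm_nonneg _)
    rw [norm_mul, Complex.norm_real, Real.norm_of_nonneg hrpos.le, mul_pow]
    exact hden w hw
  have hρd : DifferentiableOn ℂ ρ (ball 0 1) := by
    intro w hw
    apply DifferentiableAt.differentiableWithinAt
    have e1 : DifferentiableAt ℂ (fun w : E => (inner ℂ u w : ℂ)) w :=
      (innerSL ℂ u).differentiableAt
    have e2 : DifferentiableAt ℂ (fun w : E => (inner ℂ c w : ℂ)) w :=
      (innerSL ℂ c).differentiableAt
    have e3 : DifferentiableAt ℂ (fun w : E => 1 - (inner ℂ c w : ℂ)) w := e2.const_sub 1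
    have e4 : DifferentiableAt ℂ (fun w : E => (1 - (inner ℂ c w : ℂ))⁻¹) w :=
      (differentiableAt_inv (hden0 w hw)).comp w e3
    simp only [hρ, div_eq_mul_inv]
    exact (e1.const_mul (r : ℂ)).mul e4
  have hρφ : ∀ ζ, ρ (φ ζ) = ζ := by
    intro ζ
    simp only [hρ, hφ]
    rw [inner_add_right, inner_add_right, inner_smul_right, inner_smul_right, huc, hcu, huu, hcc,
      mul_zero, add_zero, zero_add, mul_one, ← hrc2]
    field_simp
  -- points of the line
  have hpt : ∀ t : ℂ, ∃ ζ, p + t • v = φ ζ := by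
    intro t
    refine ⟨(inner ℂ u p + t * ‖v‖) / r, ?_⟩
    simp only [hφ]
    rw [mul_div_cancel₀ _ hrc]
    have e : t • v = (t * ‖v‖) • u := by
      rw [← smul_smul, ← hvu]
    rw [e, add_smul, ← add_assoc, ← hpc]
  obtain ⟨a, ha⟩ := hpt 0
  obtain ⟨b, hb⟩ := hpt 1
  rw [zero_smul, add_zero] at ha
  rw [one_smul] at hb
  have ha1 : ‖a‖ < 1 := (hφball a).1 (ha ▸ hp)
  have hb1 : ‖b‖ < 1 := (hφball b).1 (hb ▸ hpv)
  have hab : a ≠ b := by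
    rintro rfl
    apply hv
    have : p + v = p := by rw [hb, ← ha]
    simpa using this
  have hgd : DifferentiableOn ℂ (ψ ∘ φ) (ball 0 1) := hd.comp hφd.differentiableOn hφm
  have hgm : MapsTo (ψ ∘ φ) (ball 0 1) (ball 0 1) := hm.comp hφm
  have hid : ∀ z : ℂ, ‖z‖ < 1 → (ρ ∘ (ψ ∘ φ)) z = z := by
    refine disc_two_fixed (ρ ∘ (ψ ∘ φ)) (hρd.comp hgd hgm) (hρm.comp hgm) ha1 hb1 hab ?_ ?_
    · simp only [Function.comp]
      rw [← ha, hfp, ha, hρφ]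
    · simp only [Function.comp]
      rw [← hb, hfq, hb, hρφ]
  -- boundary estimate
  have hest : ∀ ζ : ℂ, ‖ζ‖ < 1 → r ^ 2 * ‖ψ (φ ζ) - φ ζ‖ ≤ (1 + r) * (2 * Real.sqrt (1 - ‖ζ‖ ^ 2)) := by
    intro ζ hζ
    have hwb : ψ (φ ζ) ∈ ball (0 : E) 1 := hm ((hφball ζ).2 hζ)
    have hz := hid ζ hζ
    simp only [Function.comp] at hz
    set w := ψ (φ ζ) with hw
    simp only [hρ] at hz
    rw [div_eq_iff (hden0 w hwb)] at hz
    have h1 := ip_identity u c w r hu huc hr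
    set β : ℂ := inner ℂ u w with hβ
    set γ : ℂ := inner ℂ c w with hγ
    set d := w - β • u - c with hdd
    have hz2 : r ^ 2 * ‖β‖ ^ 2 = ‖ζ‖ ^ 2 * ‖1 - γ‖ ^ 2 := by
      have := congrArg (fun x => ‖x‖ ^ 2) hz
      simpa [norm_mul, mul_pow] using this
    have hw1 : ‖w‖ < 1 := by simpa using hwb
    have hcn : ‖c‖ ≤ 1 := by nlinarith [norm_nonneg c]
    have hγ1 : ‖1 - γ‖ ≤ 2 := by
      have g1 : ‖γ‖ ≤ ‖c‖ * ‖w‖ := norm_inner_le_norm c w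
      have g2 : ‖1 - γ‖ ≤ ‖(1 : ℂ)‖ + ‖γ‖ := norm_sub_le _ _
      rw [norm_one] at g2
      nlinarith [norm_nonneg c, norm_nonneg w]
    have hζ2 : 0 ≤ 1 - ‖ζ‖ ^ 2 := by nlinarith [norm_nonneg ζ]
    have hdn : r * ‖d‖ ≤ 2 * Real.sqrt (1 - ‖ζ‖ ^ 2) := by
      have g0 : ‖1 - γ‖ ^ 2 ≤ 4 := by nlinarith [norm_nonneg (1 - γ)]
      have g1 : 0 ≤ r ^ 2 * (1 - ‖w‖ ^ 2) :=
        mul_nonneg (by positivity) (by linarith [(hball w).1 hwb])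
      have g2 := sq_nonneg ‖(inner ℂ c d : ℂ)‖
      have g3 : (1 - ‖ζ‖ ^ 2) * ‖1 - γ‖ ^ 2 ≤ (1 - ‖ζ‖ ^ 2) * 4 := by gcongr
      refine le_of_pow_le_pow_left₀ two_ne_zero (by positivity) ?_
      rw [mul_pow, mul_pow, Real.sq_sqrt hζ2]
      linarith
    have hγd : inner ℂ c d = γ - ((‖c‖ ^ 2 : ℝ) : ℂ) := by
      rw [hdd, inner_sub_right, inner_sub_right, inner_smul_right, hcu, hcc, ← hγ]; ring
    have hβe : (r : ℂ) * (β - r * ζ) = - (ζ * inner ℂ c d) := by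
      rw [hγd]
      linear_combination hz - ζ * hrc2
    have hβn : r * ‖β - r * ζ‖ ≤ ‖d‖ := by
      have := congrArg norm hβe
      rw [norm_mul, norm_neg, norm_mul, Complex.norm_real, Real.norm_of_nonneg hrpos.le] at this
      rw [this]
      have g1 : ‖(inner ℂ c d : ℂ)‖ ≤ ‖c‖ * ‖d‖ := norm_inner_le_norm c d
      have g2 : ‖c‖ * ‖d‖ ≤ 1 * ‖d‖ := by gcongr
      calc ‖ζ‖ * ‖(inner ℂ c d : ℂ)‖ ≤ 1 * ‖(inner ℂ c d : ℂ)‖ := by gcongr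
        _ ≤ ‖d‖ := by linarith
    have hsplit : w - φ ζ = (β - r * ζ) • u + d := by
      simp only [hφ, hdd, sub_smul]; abel
    have hns : ‖w - φ ζ‖ ≤ ‖β - r * ζ‖ + ‖d‖ := by
      rw [hsplit]
      refine (norm_add_le _ _).trans ?_
      rw [norm_smul, hu, mul_one]
    calc r ^ 2 * ‖w - φ ζ‖ ≤ r ^ 2 * (‖β - r * ζ‖ + ‖d‖) := by gcongr
      _ = r * (r * ‖β - r * ζ‖) + r * (r * ‖d‖) := by ring
      _ ≤ r * ‖d‖ + r * (r * ‖d‖) := by gcongr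
      _ = (1 + r) * (r * ‖d‖) := by ring
      _ ≤ _ := by gcongr
  -- maximum principle
  have hzero : ∀ ζ : ℂ, ‖ζ‖ < 1 → ψ (φ ζ) = φ ζ := by
    intro ζ hζ
    set k : ℂ → E := fun z => ψ (φ z) - φ z with hk
    have hkd : DifferentiableOn ℂ k (ball 0 1) := hgd.sub hφd.differentiableOn
    have hR : ∀ R : ℝ, ‖ζ‖ < R → R < 1 →
        r ^ 2 * ‖k ζ‖ ≤ (1 + r) * (2 * Real.sqrt (1 - R ^ 2)) := by
      intro R h1 h2
      have hR0 : 0 < R := lt_of_le_of_lt (norm_nonneg _) h1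
      have hsub : closedBall (0 : ℂ) R ⊆ ball 0 1 := closedBall_subset_ball h2
      have hcl : DiffContOnCl ℂ k (ball 0 R) := by
        apply DifferentiableOn.diffContOnCl
        rw [closure_ball _ hR0.ne']
        exact hkd.mono hsub
      have := Complex.norm_le_of_forall_mem_frontier_norm_le (f := k) (U := ball 0 R)
        isBounded_ball hcl (C := (1 + r) * (2 * Real.sqrt (1 - R ^ 2)) / r ^ 2) (z := ζ)
        (by
          intro z hz
          rw [frontier_ball _ hR0.ne', mem_sphere_zero_iff_norm] at hz
          rw [le_div_iff₀ (by positivity)]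
          have := hest z (by rw [hz]; exact h2)
          rw [hz] at this
          linarith)
        (subset_closure (by simpa using h1))
      rw [le_div_iff₀ (by positivity)] at this
      linarith
    have hlim : Filter.Tendsto (fun R : ℝ => (1 + r) * (2 * Real.sqrt (1 - R ^ 2)))
        (nhdsWithin 1 (Iio 1)) (nhds 0) := by
      have hcont : Continuous (fun R : ℝ => (1 + r) * (2 * Real.sqrt (1 - R ^ 2))) := by fun_prop
      have := hcont.tendsto 1
      simp at this
      exact this.mono_left nhdsWithin_le_nhds
    have hle : r ^ 2 * ‖k ζ‖ ≤ 0 := by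
      apply ge_of_tendsto hlim
      filter_upwards [Ioo_mem_nhdsLT hζ] with R hRR
      exact hR R hRR.1 hRR.2
    have hk0 : ‖k ζ‖ ≤ 0 := by
      by_contra h
      push Not at h
      have : 0 < r ^ 2 * ‖k ζ‖ := by positivity
      linarith
    exact sub_eq_zero.mp (norm_le_zero_iff.mp hk0)
  intro t ht
  obtain ⟨ζ, hζ⟩ := hpt t
  rw [hζ] at ht ⊢
  exact hzero ζ ((hφball ζ).1 ht)

lemma fixed_affine (ψ : E → E) (hd : DifferentiableOn ℂ ψ (ball 0 1))
    (hm : MapsTo ψ (ball 0 1) (ball 0 1)) {p : E} (hp : p ∈ ball (0 : E) 1) (hfp : ψ p = p) :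
    ∃ s : AffineSubspace ℂ E, ∀ w ∈ ball (0 : E) 1, w ∈ s ↔ ψ w = w := by
  have hline : ∀ (q v : E), q ∈ ball (0 : E) 1 → ψ q = q → ∀ s : ℂ, s ≠ 0 →
      q + s • v ∈ ball (0 : E) 1 → ψ (q + s • v) = q + s • v →
      ∀ t : ℂ, q + t • v ∈ ball (0 : E) 1 → ψ (q + t • v) = q + t • v := by
    intro q v hq hfq s hs hsb hfs t ht
    by_cases hv : v = 0
    · subst hv; simpa using hfq
    have e : (t / s) • (s • v) = t • v := by rw [smul_smul, div_mul_cancel₀ _ hs]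
    have := line_fixed ψ hd hm (p := q) (v := s • v) (smul_ne_zero hs hv) hq hsb hfq hfs (t / s)
    rw [e] at this
    exact this ht
  have hsmall : ∀ v : E, ∃ ε : ℝ, 0 < ε ∧ ∀ s : ℝ, 0 < s → s < ε →
      p + (s : ℂ) • v ∈ ball (0 : E) 1 := by
    intro v
    have hc : Continuous (fun s : ℝ => p + (s : ℂ) • v) := by fun_prop
    have := ((isOpen_ball (x := (0 : E)) (ε := 1)).preimage hc).mem_nhds (x := (0 : ℝ)) (by simpa using hp)
    obtain ⟨ε, hε, h⟩ := Metric.mem_nhds_iff.1 this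
    refine ⟨ε, hε, fun s hs hs' => h ?_⟩
    simp [abs_of_pos hs, hs']
  let V : Submodule ℂ E :=
    { carrier := {v | ∀ t : ℂ, p + t • v ∈ ball (0 : E) 1 → ψ (p + t • v) = p + t • v}
      zero_mem' := by
        intro t _
        simpa using hfp
      smul_mem' := by
        intro a v hv t ht
        rw [smul_smul] at ht ⊢
        exact hv _ ht
      add_mem' := by
        intro v w hv hw t ht
        obtain ⟨ε₁, h1, h1'⟩ := hsmall v
        obtain ⟨ε₂, h2, h2'⟩ := hsmall w
        set s : ℝ := min ε₁ ε₂ / 2 with hs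
        have hm0 : 0 < min ε₁ ε₂ := lt_min h1 h2
        have hs0 : 0 < s := by positivity
        have hsε : s < min ε₁ ε₂ := by rw [hs]; linarith
        have b1 := h1' s hs0 (hsε.trans_le (min_le_left _ _))
        have b2 := h2' s hs0 (hsε.trans_le (min_le_right _ _))
        have f1 := hv _ b1
        have f2 := hw _ b2
        have hsc : (s : ℂ) ≠ 0 := by exact_mod_cast hs0.ne'
        -- midpoint
        have emid : (p + (s : ℂ) • v) + (1 / 2 : ℂ) • ((s : ℂ) • w - (s : ℂ) • v)
            = p + ((s : ℂ) / 2) • (v + w) := by module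
        have eend : (p + (s : ℂ) • v) + (1 : ℂ) • ((s : ℂ) • w - (s : ℂ) • v)
            = p + (s : ℂ) • w := by module
        have bmid : p + ((s : ℂ) / 2) • (v + w) ∈ ball (0 : E) 1 := by
          have e : p + ((s : ℂ) / 2) • (v + w)
              = (1 / 2 : ℂ) • ((p + (s : ℂ) • v) + (p + (s : ℂ) • w)) := by module
          rw [mem_ball_zero_iff] at b1 b2 ⊢
          rw [e, norm_smul]
          have := norm_add_le (p + (s : ℂ) • v) (p + (s : ℂ) • w)
          have e2 : ‖(1 / 2 : ℂ)‖ = 1 / 2 := by norm_num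
          rw [e2]
          linarith
        have fmid := hline (p + (s : ℂ) • v) ((s : ℂ) • w - (s : ℂ) • v) b1 f1 1 one_ne_zero
          (by rw [eend]; exact b2) (by rw [eend]; exact f2) (1 / 2) (by rw [emid]; exact bmid)
        rw [emid] at fmid
        exact hline p (v + w) hp hfp ((s : ℂ) / 2) (div_ne_zero hsc two_ne_zero) bmid fmid t ht }
  refine ⟨AffineSubspace.mk' p V, fun w hw => ?_⟩
  rw [AffineSubspace.mem_mk']
  have e1 : p + (1 : ℂ) • (w -ᵥ p) = w := by simp
  constructor
  · intro h
    have := h 1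
    rw [e1] at this
    exact this hw
  · intro h t ht
    exact hline p (w -ᵥ p) hp hfp 1 one_ne_zero (by rw [e1]; exact hw) (by rw [e1]; exact h) t ht

end ip

/-- if `f : 𝔹ⁿ → 𝔹ᴺ` is holomorphic and minimal (its image lies in no proper
affine subspace of `ℂᴺ`), then every automorphism `ψ` of `𝔹ᴺ` with `ψ ∘ f = f` is the
identity (on the ball, where an automorphism is determined). -/
theorem stmt4 {n N : ℕ}
    (f : EuclideanSpace ℂ (Fin n) → EuclideanSpace ℂ (Fin N))
    (hf : DifferentiableOn ℂ f (ball (0 : EuclideanSpace ℂ (Fin n)) 1))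
    (hfm : MapsTo f (ball (0 : EuclideanSpace ℂ (Fin n)) 1) (ball (0 : EuclideanSpace ℂ (Fin N)) 1))
    (hmin : ∀ s : AffineSubspace ℂ (EuclideanSpace ℂ (Fin N)),
      (∀ z ∈ ball (0 : EuclideanSpace ℂ (Fin n)) 1, f z ∈ s) → s = ⊤) :
    ∀ ψ : EuclideanSpace ℂ (Fin N) → EuclideanSpace ℂ (Fin N), IsBallAut ψ →
      (∀ z ∈ ball (0 : EuclideanSpace ℂ (Fin n)) 1, ψ (f z) = f z) →
      ∀ w ∈ ball (0 : EuclideanSpace ℂ (Fin N)) 1, ψ w = w := by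
  intro ψ hψ hfix w hw
  have h0 : (0 : EuclideanSpace ℂ (Fin n)) ∈ ball (0 : EuclideanSpace ℂ (Fin n)) 1 := by simp
  obtain ⟨s, hs⟩ := fixed_affine ψ hψ.1 hψ.2.1 (hfm h0) (hfix 0 h0)
  have htop := hmin s (fun z hz => (hs _ (hfm hz)).2 (hfix z hz))
  refine (hs w hw).1 ?_
  rw [htop]
  exact AffineSubspace.mem_top ℂ _ w
end
end

section
/- Let f : 𝔹ⁿ → 𝔹ᴺ be holomorphic. Then H_f is trivial if and only if f is minimal (i.e., the image of f spans an affine subspace of full dimension N). -/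
noncomputable section
open Metric Set

section Helpers

variable {E : Type*} [NormedAddCommGroup E] [InnerProductSpace ℂ E]

def bk (a : E) (c : ℂ) : ℂ := 2 / ((‖a‖ : ℂ) ^ 2 - (‖c‖ : ℂ) ^ 2)

def bL (a : E) (c : ℂ) (w : E) : ℂ := inner ℂ a w - c

def bD (a : E) (c : ℂ) (w : E) : ℂ := 1 - bk a c * bL a c w * starRingEnd ℂ c

def bNum (a : E) (c : ℂ) (w : E) : E := w - (bk a c * bL a c w) • a

def bRefl (a : E) (c : ℂ) (w : E) : E := (bD a c w)⁻¹ • bNum a c w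

lemma bk_mul (a : E) (c : ℂ) (h : ‖c‖ < ‖a‖) :
    bk a c * ((‖a‖ : ℂ) ^ 2 - (‖c‖ : ℂ) ^ 2) = 2 := by
  unfold bk
  apply div_mul_cancel₀
  have : (‖a‖ ^ 2 - ‖c‖ ^ 2 : ℝ) ≠ 0 := by nlinarith [norm_nonneg c]
  exact_mod_cast this

lemma bk_conj (a : E) (c : ℂ) : starRingEnd ℂ (bk a c) = bk a c := by
  have h2 : starRingEnd ℂ (2 : ℂ) = 2 := Complex.conj_ofNat 2
  simp [bk, h2]

lemma b_norm (a : E) (c : ℂ) (h : ‖c‖ < ‖a‖) (w : E) :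
    ‖bNum a c w‖ ^ 2 - ‖bD a c w‖ ^ 2 = ‖w‖ ^ 2 - 1 := by
  have hk := bk_mul a c h
  have hk' := bk_conj a c
  have hcc : starRingEnd ℂ c * c = (‖c‖ : ℂ) ^ 2 := Complex.conj_mul' c
  have h1 : ((‖bNum a c w‖ : ℂ)) ^ 2 = (‖w‖ : ℂ) ^ 2
      - bk a c * bL a c w * inner ℂ w a
      - bk a c * starRingEnd ℂ (bL a c w) * inner ℂ a w
      + bk a c ^ 2 * bL a c w * starRingEnd ℂ (bL a c w) * (‖a‖ : ℂ) ^ 2 := by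
    have e1 := inner_self_eq_norm_sq_to_K (𝕜 := ℂ) (bNum a c w)
    have e2 := inner_self_eq_norm_sq_to_K (𝕜 := ℂ) w
    have e3 := inner_self_eq_norm_sq_to_K (𝕜 := ℂ) a
    simp only [Complex.coe_algebraMap] at e1 e2 e3
    rw [← e1, ← e2, ← e3]
    simp only [bNum, inner_sub_left, inner_sub_right, inner_smul_left, inner_smul_right, map_mul,
      hk']
    ring
  have h2 : ((‖bD a c w‖ : ℂ)) ^ 2 = 1 - bk a c * bL a c w * starRingEnd ℂ c
      - bk a c * starRingEnd ℂ (bL a c w) * c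
      + bk a c ^ 2 * bL a c w * starRingEnd ℂ (bL a c w) * (‖c‖ : ℂ) ^ 2 := by
    rw [← Complex.conj_mul', ← hcc]
    simp only [bD, map_sub, map_mul, map_one, hk', Complex.conj_conj]
    ring
  have hL : starRingEnd ℂ (bL a c w) = inner ℂ w a - starRingEnd ℂ c := by
    simp [bL]
  have : ((‖bNum a c w‖ : ℂ)) ^ 2 - ((‖bD a c w‖ : ℂ)) ^ 2 = (‖w‖ : ℂ) ^ 2 - 1 := by
    rw [h1, h2]
    have hw : inner ℂ w a = starRingEnd ℂ (bL a c w) + starRingEnd ℂ c := by rw [hL]; ring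
    have hw2 : inner ℂ a w = bL a c w + c := by simp [bL]
    rw [hw, hw2]
    linear_combination bk a c * bL a c w * starRingEnd ℂ (bL a c w) * hk
  exact_mod_cast this

lemma bD_ne (a : E) (c : ℂ) (h : ‖c‖ < ‖a‖) {w : E} (hw : w ∈ ball (0 : E) 1) :
    bD a c w ≠ 0 := by
  intro h0
  have := b_norm a c h w
  rw [mem_ball_zero_iff] at hw
  rw [h0, norm_zero] at this
  nlinarith [norm_nonneg w, sq_nonneg ‖bNum a c w‖]

lemma bRefl_maps (a : E) (c : ℂ) (h : ‖c‖ < ‖a‖) :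
    MapsTo (bRefl a c) (ball (0 : E) 1) (ball (0 : E) 1) := by
  intro w hw
  have hD := bD_ne a c h hw
  have := b_norm a c h w
  rw [mem_ball_zero_iff] at hw ⊢
  have hp : 0 < ‖bD a c w‖ := norm_pos_iff.2 hD
  rw [bRefl, norm_smul, norm_inv, inv_mul_lt_iff₀ hp, mul_one]
  apply lt_of_pow_lt_pow_left₀ 2 hp.le
  nlinarith [norm_nonneg w]

lemma bRefl_diff (a : E) (c : ℂ) (h : ‖c‖ < ‖a‖) :
    DifferentiableOn ℂ (bRefl a c) (ball (0 : E) 1) := by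
  have hL : Differentiable ℂ (bL a c) := by
    have : bL a c = fun w => innerSL ℂ a w - c := by ext w; simp [bL]
    rw [this]; fun_prop
  have hD : Differentiable ℂ (bD a c) := by unfold bD; fun_prop
  have hN : Differentiable ℂ (bNum a c) := by unfold bNum; fun_prop
  intro w hw
  exact (((hD w).inv (bD_ne a c h hw)).smul (hN w)).differentiableWithinAt

lemma bRefl_L (a : E) (c : ℂ) (h : ‖c‖ < ‖a‖) {w : E} (hw : w ∈ ball (0 : E) 1) :
    bL a c (bRefl a c w) = - bL a c w / bD a c w := by
  have hD := bD_ne a c h hw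
  have hk := bk_mul a c h
  have hcc : starRingEnd ℂ c * c = (‖c‖ : ℂ) ^ 2 := Complex.conj_mul' c
  have e3 := inner_self_eq_norm_sq_to_K (𝕜 := ℂ) a
  simp only [Complex.coe_algebraMap] at e3
  have hw2 : inner ℂ a w = bL a c w + c := by simp [bL]
  rw [eq_div_iff hD]
  have : bL a c (bRefl a c w) = (bD a c w)⁻¹ * (inner ℂ a w - bk a c * bL a c w * (‖a‖ : ℂ) ^ 2) - c := by
    rw [← e3]
    conv_lhs => rw [bL, bRefl, bNum, inner_smul_right, inner_sub_right, inner_smul_right]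
  rw [this, sub_mul, mul_right_comm, inv_mul_cancel₀ hD, hw2]
  rw [bD]
  linear_combination (-bL a c w) * hk + bk a c * bL a c w * hcc

lemma bRefl_invol (a : E) (c : ℂ) (h : ‖c‖ < ‖a‖) {w : E} (hw : w ∈ ball (0 : E) 1) :
    bRefl a c (bRefl a c w) = w := by
  have hD := bD_ne a c h hw
  have h1 : bD a c (bRefl a c w) = (bD a c w)⁻¹ := by
    rw [bD, bRefl_L a c h hw]
    field_simp
    rw [bD]; ring
  rw [bRefl, h1, inv_inv, bNum, bRefl_L a c h hw, bRefl, smul_sub, smul_smul, mul_inv_cancel₀ hD,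
    one_smul, smul_smul]
  have : bD a c w * (bk a c * (-bL a c w / bD a c w)) = - (bk a c * bL a c w) := by
    field_simp
  rw [this, bNum]
  simp

lemma bRefl_fix (a : E) (c : ℂ) {w : E} (hw : bL a c w = 0) : bRefl a c w = w := by
  simp [bRefl, bD, bNum, hw]

lemma bRefl_nonfix (a : E) (c : ℂ) (h : ‖c‖ < ‖a‖) {w : E} (hw : w ∈ ball (0 : E) 1)
    (hf : bRefl a c w = w) : bL a c w = 0 := by
  by_contra hL
  have hD := bD_ne a c h hw
  have hk : bk a c ≠ 0 := fun h0 => by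
    have := bk_mul a c h
    rw [h0, zero_mul] at this
    norm_num at this
  rw [bRefl, inv_smul_eq_iff₀ hD, bNum, bD, sub_smul, one_smul, sub_right_inj, mul_smul,
    mul_smul (bk a c * bL a c w), ← mul_smul] at hf
  have h2 : a = starRingEnd ℂ c • w := smul_right_injective E (mul_ne_zero hk hL) hf
  have h3 : ‖a‖ = ‖c‖ * ‖w‖ := by
    conv_lhs => rw [h2, norm_smul, RCLike.norm_conj]
  rw [mem_ball_zero_iff] at hw
  nlinarith [norm_nonneg c, norm_nonneg w]

/-- A Moebius involution sending `p` to `0`. -/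
lemma exists_moebius (p : E) (hp : p ∈ ball (0 : E) 1) :
    ∃ (φ : E → E) (d : E → ℂ) (T : E →ᵃ[ℂ] E),
      DifferentiableOn ℂ φ (ball (0 : E) 1) ∧ MapsTo φ (ball (0 : E) 1) (ball (0 : E) 1) ∧
      (∀ w ∈ ball (0 : E) 1, φ (φ w) = w) ∧ φ 0 = p ∧
      (∀ w ∈ ball (0 : E) 1, d w ≠ 0 ∧ φ w = (d w)⁻¹ • T w) := by
  by_cases h0 : p = 0
  · refine ⟨id, fun _ => 1, AffineMap.id ℂ E, differentiableOn_id, fun x hx => hx, fun _ _ => rfl,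
      h0.symm, fun w _ => ⟨one_ne_zero, by simp⟩⟩
  have hp0 : 0 < ‖p‖ := norm_pos_iff.2 h0
  rw [mem_ball_zero_iff] at hp
  set s := Real.sqrt (1 - ‖p‖ ^ 2) with hs
  have hpos : 0 < 1 - ‖p‖ ^ 2 := by nlinarith
  have hs2 : s ^ 2 = 1 - ‖p‖ ^ 2 := Real.sq_sqrt hpos.le
  have hs0 : 0 < s := Real.sqrt_pos.2 hpos
  have hs1 : s < 1 := by nlinarith
  have hnc : ‖((1 - s : ℝ) : ℂ)‖ = 1 - s := by
    rw [Complex.norm_real, Real.norm_eq_abs, abs_of_pos (by linarith)]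
  have hc : ‖((1 - s : ℝ) : ℂ)‖ < ‖p‖ := by
    rw [hnc]
    apply lt_of_pow_lt_pow_left₀ 2 hp0.le
    nlinarith
  set c : ℂ := ((1 - s : ℝ) : ℂ) with hcdef
  refine ⟨bRefl p c, bD p c,
    AffineMap.id ℂ E - ((bk p c) • ((innerSL ℂ p).toLinearMap.smulRight p).toAffineMap
      - AffineMap.const ℂ E ((bk p c * c) • p)),
    bRefl_diff p c hc, bRefl_maps p c hc, fun w hw => bRefl_invol p c hc hw, ?_, ?_⟩
  · have hk := bk_mul p c hc
    rw [hnc] at hk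
    have hkr : bk p c * (s * (1 - s)) = 1 := by
      have : ((‖p‖ : ℂ)) ^ 2 = 1 - (s : ℂ) ^ 2 := by
        have : ‖p‖ ^ 2 = 1 - s ^ 2 := by linarith
        exact_mod_cast this
      rw [this] at hk
      push_cast at hk
      linear_combination hk / 2
    have hD := bD_ne p c hc (w := 0) (by simp)
    rw [bRefl, inv_smul_eq_iff₀ hD]
    simp only [bD, bNum, bL, inner_zero_right, zero_sub, ← neg_smul]
    congr 1
    have hcv : c = 1 - (s : ℂ) := by rw [hcdef]; push_cast; rfl
    have hcj : starRingEnd ℂ c = 1 - (s : ℂ) := by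
      rw [hcdef, Complex.conj_ofReal]; push_cast; rfl
    rw [hcj]
    generalize bk p c = k at hkr ⊢
    rw [hcv]
    linear_combination hkr
  · intro w hw
    refine ⟨bD_ne p c hc hw, ?_⟩
    rw [bRefl]
    congr 1
    simp [bNum, bL, mul_sub, sub_smul, mul_smul]

/-- Cartan: a ball automorphism fixing the origin is linear. -/
lemma cartan_linear (χ χ' : E → E)
    (hd : DifferentiableOn ℂ χ (ball (0 : E) 1)) (hm : MapsTo χ (ball (0 : E) 1) (ball (0 : E) 1))
    (hd' : DifferentiableOn ℂ χ' (ball (0 : E) 1))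
    (hm' : MapsTo χ' (ball (0 : E) 1) (ball (0 : E) 1))
    (hi : ∀ z ∈ ball (0 : E) 1, χ' (χ z) = z) (h0 : χ 0 = 0) :
    ∀ z ∈ ball (0 : E) 1, χ z = fderiv ℂ χ 0 z := by
  letI : InnerProductSpace ℝ E := InnerProductSpace.rclikeToReal ℂ E
  have h0' : χ' 0 = 0 := by
    have := hi 0 (by simp)
    rwa [h0] at this
  have hnorm : ∀ z ∈ ball (0 : E) 1, ‖χ z‖ = ‖z‖ := by
    intro z hz
    apply le_antisymm
    · exact Complex.norm_le_norm_of_mapsTo_ball hd (hm.mono_right ball_subset_closedBall) h0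
        (mem_ball_zero_iff.1 hz)
    · have := Complex.norm_le_norm_of_mapsTo_ball hd' (hm'.mono_right ball_subset_closedBall) h0'
        (mem_ball_zero_iff.1 (hm hz))
      rwa [hi z hz] at this
  intro z hz
  by_cases hz0 : z = 0
  · rw [hz0, h0, map_zero]
  have hr : 0 < ‖z‖ := norm_pos_iff.2 hz0
  have hz1 : ‖z‖ < 1 := mem_ball_zero_iff.1 hz
  have hmap : MapsTo (fun t : ℂ => t • z) (ball (0 : ℂ) (1 / ‖z‖)) (ball (0 : E) 1) := by
    intro t ht
    rw [mem_ball_zero_iff] at ht ⊢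
    rw [norm_smul]
    rwa [lt_div_iff₀ hr] at ht
  have h1 : (1 : ℂ) ∈ ball (0 : ℂ) (1 / ‖z‖) := by
    rw [mem_ball_zero_iff, norm_one, lt_div_iff₀ hr]; linarith
  have hdg : DifferentiableOn ℂ (fun t : ℂ => χ (t • z)) (ball (0 : ℂ) (1 / ‖z‖)) :=
    hd.comp (by fun_prop) hmap
  have hds : dslope (fun t : ℂ => χ (t • z)) 0 1 = χ z := by
    rw [dslope_of_ne _ one_ne_zero, slope_def_module]
    simp [h0]
  have key := Complex.affine_of_mapsTo_ball_of_norm_dslope_eq_div (R₂ := 1) hdg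
    (by
      intro t ht
      simp only [zero_smul, h0]
      exact ball_subset_closedBall (hm (hmap ht))) h1
    (by rw [hds, hnorm z hz]; simp)
  rw [hds] at key
  have hA : HasFDerivAt χ (fderiv ℂ χ 0) ((0 : ℂ) • z) := by
    rw [zero_smul]
    exact (hd.differentiableAt (ball_mem_nhds _ one_pos)).hasFDerivAt
  have hsm : HasDerivAt (fun t : ℂ => t • z) z 0 := by
    simpa using (hasDerivAt_id (0 : ℂ)).smul_const z
  have hg : HasDerivAt (fun t : ℂ => χ (t • z)) (fderiv ℂ χ 0 z) 0 :=
    hA.comp_hasDerivAt 0 hsm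
  have hg2 : HasDerivAt (fun t : ℂ => t • χ z) (χ z) 0 := by
    simpa using (hasDerivAt_id (0 : ℂ)).smul_const (χ z)
  have hev : (fun t : ℂ => χ (t • z)) =ᶠ[nhds 0] (fun t : ℂ => t • χ z) := by
    filter_upwards [ball_mem_nhds (0 : ℂ) (by positivity : 0 < 1 / ‖z‖)] with t ht
    simpa [h0] using key ht
  exact (hg.unique (hg2.congr_of_eventuallyEq hev)).symm

end Helpers

/-- `H_f` is trivial iff `f` is minimal (its image lies in no proper affine
subspace of `ℂᴺ`). -/
theorem stmt5 {n N : ℕ}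
    (f : EuclideanSpace ℂ (Fin n) → EuclideanSpace ℂ (Fin N))
    (hf : DifferentiableOn ℂ f (ball (0 : EuclideanSpace ℂ (Fin n)) 1))
    (hfm : MapsTo f (ball (0 : EuclideanSpace ℂ (Fin n)) 1) (ball (0 : EuclideanSpace ℂ (Fin N)) 1)) :
    (∀ ψ : EuclideanSpace ℂ (Fin N) → EuclideanSpace ℂ (Fin N), IsBallAut ψ →
        (∀ z ∈ ball (0 : EuclideanSpace ℂ (Fin n)) 1, ψ (f z) = f z) →
        ∀ w ∈ ball (0 : EuclideanSpace ℂ (Fin N)) 1, ψ w = w) ↔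
      (∀ s : AffineSubspace ℂ (EuclideanSpace ℂ (Fin N)),
        (∀ z ∈ ball (0 : EuclideanSpace ℂ (Fin n)) 1, f z ∈ s) → s = ⊤) := by
  constructor
  · intro H s hs
    by_contra hne
    have h0 : (0 : EuclideanSpace ℂ (Fin n)) ∈ ball (0 : EuclideanSpace ℂ (Fin n)) 1 := by simp
    have hps := hs 0 h0
    have hp := hfm h0
    set p := f 0 with hpdef
    have hdir : s.direction ≠ ⊤ := by
      intro hd
      exact hne ((AffineSubspace.direction_eq_top_iff_of_nonempty ⟨p, hps⟩).1 hd)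
    have hperp : s.directionᗮ ≠ ⊥ := fun h => hdir (Submodule.orthogonal_eq_bot_iff.1 h)
    obtain ⟨a, ha, ha0⟩ := Submodule.exists_mem_ne_zero_of_ne_bot hperp
    have hna : 0 < ‖a‖ := norm_pos_iff.2 ha0
    set c : ℂ := inner ℂ a p with hcdef
    have hc : ‖c‖ < ‖a‖ := by
      have := norm_inner_le_norm (𝕜 := ℂ) a p
      rw [mem_ball_zero_iff] at hp
      nlinarith
    have hfix : ∀ z ∈ ball (0 : EuclideanSpace ℂ (Fin n)) 1, bRefl a c (f z) = f z := by
      intro z hz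
      apply bRefl_fix
      have h1 : f z - p ∈ s.direction := AffineSubspace.vsub_mem_direction (hs z hz) hps
      have h2 := (Submodule.mem_orthogonal' _ _).1 ha _ h1
      rw [inner_sub_right] at h2
      exact h2
    have hall := H (bRefl a c) ⟨bRefl_diff a c hc, bRefl_maps a c hc, bRefl a c,
      bRefl_diff a c hc, bRefl_maps a c hc, fun z hz => bRefl_invol a c hc hz,
      fun z hz => bRefl_invol a c hc hz⟩ hfix
    have hL : ∀ w ∈ ball (0 : EuclideanSpace ℂ (Fin N)) 1, inner ℂ a w = c := fun w hw =>
      sub_eq_zero.1 (bRefl_nonfix a c hc hw (hall w hw))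
    have hc0 : c = 0 := by
      rw [← hL 0 (by simp), inner_zero_right]
    have hb : ((1 / (2 * ‖a‖) : ℝ) : ℂ) • a ∈ ball (0 : EuclideanSpace ℂ (Fin N)) 1 := by
      rw [mem_ball_zero_iff, norm_smul, Complex.norm_real, Real.norm_eq_abs,
        abs_of_pos (by positivity)]
      field_simp
      norm_num
    have h3 := hL _ hb
    rw [hc0, inner_smul_right, mul_eq_zero, inner_self_eq_zero] at h3
    rcases h3 with h3 | h3
    · have : (1 / (2 * ‖a‖) : ℝ) ≠ 0 := by positivity
      exact this (by exact_mod_cast h3)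
    · exact ha0 h3
  · rintro H ψ ⟨hψd, hψm, ψ', hd', hm', hi, hi'⟩ hfix w hw
    have h0 : (0 : EuclideanSpace ℂ (Fin n)) ∈ ball (0 : EuclideanSpace ℂ (Fin n)) 1 := by simp
    have h0N : (0 : EuclideanSpace ℂ (Fin N)) ∈ ball (0 : EuclideanSpace ℂ (Fin N)) 1 := by simp
    obtain ⟨φ, d, T, hφd, hφm, hφi, hφ0, hφT⟩ := exists_moebius (f 0) (hfm h0)
    have hφp : φ (f 0) = 0 := by rw [← hφ0]; exact hφi 0 h0N
    have hlin := cartan_linear (φ ∘ ψ ∘ φ) (φ ∘ ψ' ∘ φ)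
      (hφd.comp (hψd.comp hφd hφm) (hψm.comp hφm)) (hφm.comp (hψm.comp hφm))
      (hφd.comp (hd'.comp hφd hφm) (hm'.comp hφm)) (hφm.comp (hm'.comp hφm))
      (by
        intro z hz
        simp only [Function.comp]
        rw [hφi _ (hψm (hφm hz)), hi _ (hφm hz), hφi z hz])
      (by
        simp only [Function.comp]
        rw [hφ0, hfix 0 h0, hφp])
    set A := fderiv ℂ (φ ∘ ψ ∘ φ) 0 with hA
    let V : Submodule ℂ (EuclideanSpace ℂ (Fin N)) :=
      LinearMap.ker (A.toLinearMap - LinearMap.id)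
    have hV : ∀ x, x ∈ V ↔ A x = x := by
      intro x
      simp [V, LinearMap.mem_ker, sub_eq_zero]
    have hTV : ∀ x ∈ ball (0 : EuclideanSpace ℂ (Fin N)) 1, T x ∈ V ↔ φ x ∈ V := by
      intro x hx
      rw [(hφT x hx).2, Submodule.smul_mem_iff _ (inv_ne_zero (hφT x hx).1)]
    have hfixV : ∀ x ∈ ball (0 : EuclideanSpace ℂ (Fin N)) 1, ψ x = x ↔ φ x ∈ V := by
      intro x hx
      rw [hV, ← hlin _ (hφm hx)]
      simp only [Function.comp]
      rw [hφi x hx]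
      constructor
      · intro h; rw [h]
      · intro h
        have h2 := congrArg φ h
        rwa [hφi _ (hψm hx), hφi x hx] at h2
    have htop := H (V.toAffineSubspace.comap T) (by
      intro z hz
      rw [AffineSubspace.mem_comap, Submodule.mem_toAffineSubspace, hTV _ (hfm hz),
        ← hfixV _ (hfm hz)]
      exact hfix z hz)
    rw [hfixV w hw, ← hTV w hw, ← Submodule.mem_toAffineSubspace, ← AffineSubspace.mem_comap, htop]
    exact AffineSubspace.mem_top ℂ _ w
end
end

section
/- Let f : 𝔹ⁿ → 𝔹ᴺ be a minimal holomorphic map. Then for every γ ∈ Γ_f there is a unique ψ ∈ Aut(𝔹ᴺ) with f ∘ γ = ψ ∘ f, and the map Φ : Γ_f → Aut(𝔹ᴺ) sending γ to this ψ is a group homomorphism; in particular f(γ(z)) = Φ(γ)(f(z)) for all z, i.e., f is equivariant with respect to Φ. -/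
noncomputable section
open Metric Set

section helpers
variable {E : Type*} [NormedAddCommGroup E] [InnerProductSpace ℂ E]

theorem fix_zero_line (χ : E → E) (hd : DifferentiableOn ℂ χ (ball (0 : E) 1))
    (hm : MapsTo χ (ball (0 : E) 1) (ball (0 : E) 1)) (h0 : χ 0 = 0)
    (q : E) (hq : q ∈ ball (0 : E) 1) (hqf : χ q = q) (c : ℂ)
    (hc : c • q ∈ ball (0 : E) 1) : χ (c • q) = c • q := by
  rcases eq_or_ne q 0 with rfl | hq0
  · simpa using h0
  have hn : (0 : ℝ) < ‖q‖ := norm_pos_iff.mpr hq0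
  have hnc : (‖q‖ : ℂ) ≠ 0 := by exact_mod_cast hn.ne'
  set u : E := (‖q‖ : ℂ)⁻¹ • q with hu
  have hun : ‖u‖ = 1 := by
    rw [hu, norm_smul, norm_inv, Complex.norm_real, norm_norm, inv_mul_cancel₀ hn.ne']
  have huq : (‖q‖ : ℂ) • u = q := by rw [hu, smul_inv_smul₀ hnc]
  have hmap : MapsTo (fun l : ℂ => l • u) (ball (0 : ℂ) 1) (ball (0 : E) 1) := by
    intro l hl
    simp only [mem_ball_zero_iff] at hl ⊢
    rw [norm_smul, hun, mul_one]; exact hl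
  have hG : DifferentiableOn ℂ (fun l : ℂ => χ (l • u)) (ball (0 : ℂ) 1) :=
    hd.comp (by fun_prop) hmap
  have hz0 : (‖q‖ : ℂ) ∈ ball (0 : ℂ) 1 := by
    simpa using hq
  have hds : dslope (fun l : ℂ => χ (l • u)) 0 (‖q‖ : ℂ) = u := by
    rw [dslope_of_ne _ hnc, slope_def_module]
    simp only [zero_smul, h0, huq, hqf, sub_zero]
    rw [hu]
  have : UniformConvexSpace E :=
    @InnerProductSpace.toUniformConvexSpace E _ (InnerProductSpace.rclikeToReal ℂ E)
  have : StrictConvexSpace ℝ E := UniformConvexSpace.toStrictConvexSpace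
  have key := Complex.affine_of_mapsTo_ball_of_norm_dslope_eq_div (R₂ := 1) hG
    (by
      intro l hl
      have := hm (hmap hl)
      simp only [zero_smul, h0]
      exact ball_subset_closedBall this) hz0 (by rw [hds, hun]; norm_num)
  have hcl : c * (‖q‖ : ℂ) ∈ ball (0 : ℂ) 1 := by
    simpa [norm_smul] using hc
  have := key hcl
  simp only [zero_smul, h0, hds, sub_zero, zero_add, mul_smul, huq] at this
  exact this

def mobS (a : E) : ℝ := Real.sqrt (1 - ‖a‖ ^ 2)

def mob (a z : E) : E :=
  (1 - inner ℂ a z)⁻¹ •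
    ((1 - (1 + (mobS a : ℂ))⁻¹ * inner ℂ a z) • a - (mobS a : ℂ) • z)

theorem mobS_pos {a : E} (ha : a ∈ ball (0 : E) 1) : 0 < mobS a := by
  have h : ‖a‖ < 1 := by simpa using ha
  apply Real.sqrt_pos.mpr
  nlinarith [norm_nonneg a]

theorem mobS_sq {a : E} (ha : a ∈ ball (0 : E) 1) : ‖a‖ ^ 2 = 1 - mobS a ^ 2 := by
  have h : ‖a‖ < 1 := by simpa using ha
  rw [mobS, Real.sq_sqrt (by nlinarith [norm_nonneg a])]
  ring

theorem mob_inner_self {a : E} (ha : a ∈ ball (0 : E) 1) :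
    inner ℂ a a = 1 - (mobS a : ℂ) ^ 2 := by
  rw [inner_self_eq_norm_sq_to_K]
  have := mobS_sq ha
  have h2 := congrArg (fun x : ℝ => (x : ℂ)) this
  push_cast at h2
  exact h2

theorem mob_den {a z : E} (ha : a ∈ ball (0 : E) 1) (hz : z ∈ ball (0 : E) 1) :
    (1 : ℂ) - inner ℂ a z ≠ 0 := by
  intro h
  have h1 : inner ℂ a z = 1 := (sub_eq_zero.mp h).symm
  have h2 := norm_inner_le_norm (𝕜 := ℂ) a z
  rw [h1] at h2
  simp only [mem_ball_zero_iff] at ha hz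
  simp at h2
  nlinarith [norm_nonneg a, norm_nonneg z]

theorem mobS_den {a : E} (ha : a ∈ ball (0 : E) 1) : (1 : ℂ) + (mobS a : ℂ) ≠ 0 := by
  have := mobS_pos ha
  have h : (1 : ℝ) + mobS a ≠ 0 := by positivity
  exact_mod_cast h

theorem mob_diff {a : E} (ha : a ∈ ball (0 : E) 1) :
    DifferentiableOn ℂ (mob a) (ball (0 : E) 1) := by
  have h : Differentiable ℂ (fun z : E => inner ℂ a z) := (innerSL ℂ a).differentiable
  unfold mob
  apply DifferentiableOn.smul
  · apply DifferentiableOn.inv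
    · fun_prop
    · intro z hz
      exact mob_den ha hz
  · fun_prop

theorem mob_mapsTo {a : E} (ha : a ∈ ball (0 : E) 1) :
    MapsTo (mob a) (ball (0 : E) 1) (ball (0 : E) 1) := by
  intro z hz
  have hden := mob_den ha hz
  have hs := mobS_pos ha
  have hsq := mobS_sq ha
  have hd := mobS_den ha
  simp only [mem_ball_zero_iff] at hz ⊢
  unfold mob
  rw [norm_smul, norm_inv, inv_mul_lt_iff₀ (norm_pos_iff.mpr hden), mul_one]
  apply lt_of_pow_lt_pow_left₀ 2 (norm_nonneg _)
  rw [@norm_sub_sq ℂ, norm_smul, norm_smul, inner_smul_left, inner_smul_right, mul_pow, mul_pow, hsq]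
  rw [Complex.norm_real, Real.norm_eq_abs, sq_abs]
  set c : ℂ := inner ℂ a z with hc
  set s : ℝ := mobS a
  have e1 : ((1 + (s : ℂ))⁻¹ : ℂ) = (((1 + s)⁻¹ : ℝ) : ℂ) := by push_cast; rfl
  rw [e1]
  have hr : (1 + s)⁻¹ * (1 + s) = 1 := inv_mul_cancel₀ (by positivity)
  set r : ℝ := (1 + s)⁻¹
  rw [Complex.sq_norm, Complex.sq_norm, Complex.normSq_apply, Complex.normSq_apply]
  simp
  have hz2 : ‖z‖ ^ 2 < 1 := by nlinarith [norm_nonneg z]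
  have hpos : 0 < s ^ 2 * (1 - ‖z‖ ^ 2) := by
    apply mul_pos (by positivity); linarith
  have hs' : s * r = 1 - r := by linarith
  have hid : ((1 - r * c.re) * (1 - r * c.re) + r * c.im * (r * c.im)) * (1 - s ^ 2)
      - 2 * (s * ((1 - r * c.re) * c.re - r * c.im * c.im))
      = (1 - c.re) ^ 2 + c.im ^ 2 - s ^ 2 := by
    have hs2 : s = r⁻¹ - 1 := by rw [inv_inv]; ring
    have hr0 : r ≠ 0 := by positivity
    rw [hs2]
    field_simp
    ring
  nlinarith

theorem mob_inner {a z : E} (ha : a ∈ ball (0 : E) 1) (hz : z ∈ ball (0 : E) 1) :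
    inner ℂ a (mob a z) =
      (1 - (mobS a : ℂ) ^ 2 - inner ℂ a z) * (1 - inner ℂ a z)⁻¹ := by
  have hden := mob_den ha hz
  have hd := mobS_den ha
  unfold mob
  rw [inner_smul_right, inner_sub_right, inner_smul_right, inner_smul_right, mob_inner_self ha]
  field_simp
  ring

theorem mob_invol {a z : E} (ha : a ∈ ball (0 : E) 1) (hz : z ∈ ball (0 : E) 1) :
    mob a (mob a z) = z := by
  have hden := mob_den ha hz
  have hd := mobS_den ha
  have hs : (mobS a : ℂ) ≠ 0 := by exact_mod_cast (mobS_pos ha).ne'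
  rw [mob, mob_inner ha hz, mob]
  set c : ℂ := inner ℂ a z with hc
  set s : ℂ := (mobS a : ℂ)
  have h1 : 1 - (1 - s ^ 2 - c) * (1 - c)⁻¹ = s ^ 2 * (1 - c)⁻¹ := by
    field_simp; ring
  rw [h1]
  match_scalars
  · field_simp
    ring
  · field_simp

theorem mob_zero (a : E) : mob a 0 = a := by simp [mob]

theorem mob_self {a : E} (ha : a ∈ ball (0 : E) 1) : mob a a = 0 := by
  have h := mob_invol ha (z := 0) (by simp)
  rwa [mob_zero] at h

theorem mob_line {a v : E} (t : ℂ) (ha : a ∈ ball (0 : E) 1) (hv : a + v ∈ ball (0 : E) 1) :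
    ∃ k : ℂ, mob a (a + t • v) = k • mob a (a + v) := by
  have hden := mob_den ha hv
  have hd := mobS_den ha
  refine ⟨(1 - inner ℂ a (a + t • v))⁻¹ * t * (1 - inner ℂ a (a + v)), ?_⟩
  unfold mob
  rw [smul_smul, mul_assoc _ (1 - inner ℂ a (a + v)), mul_inv_cancel₀ hden, mul_one, mul_smul]
  congr 1
  rw [inner_add_right, inner_add_right, inner_smul_right, mob_inner_self ha]
  match_scalars
  · field_simp
    ring
  · ring

theorem fix_line (χ : E → E) (hd : DifferentiableOn ℂ χ (ball (0 : E) 1))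
    (hm : MapsTo χ (ball (0 : E) 1) (ball (0 : E) 1))
    (p v : E) (hp : p ∈ ball (0 : E) 1) (hpf : χ p = p) (hv : p + v ∈ ball (0 : E) 1)
    (hvf : χ (p + v) = p + v) (t : ℂ)
    (ht : p + t • v ∈ ball (0 : E) 1) : χ (p + t • v) = p + t • v := by
  obtain ⟨k, hk⟩ := mob_line t hp hv
  have hmp := mob_mapsTo hp
  have h := fix_zero_line (mob p ∘ χ ∘ mob p)
    ((mob_diff hp).comp (hd.comp (mob_diff hp) hmp) (hm.comp hmp))
    (hmp.comp (hm.comp hmp)) (by simp [mob_zero, hpf, mob_self hp])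
    (mob p (p + v)) (hmp hv) (by simp [mob_invol hp hv, hvf]) k (by rw [← hk]; exact hmp ht)
  rw [← hk] at h
  simp only [Function.comp_apply, mob_invol hp ht] at h
  have h2 := congrArg (mob p) h
  rwa [mob_invol hp (hm ht), mob_invol hp ht] at h2

theorem near_ball {p : E} (hp : p ∈ ball (0 : E) 1) (u v : E) :
    ∃ t : ℂ, t ≠ 0 ∧ p + t • u ∈ ball (0 : E) 1 ∧ p + t • v ∈ ball (0 : E) 1 := by
  have hpn : ‖p‖ < 1 := by simpa using hp
  set d : ℝ := (1 - ‖p‖) / (‖u‖ + ‖v‖ + 1) with hdd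
  have hd : 0 < d := div_pos (by linarith) (by positivity)
  have h2 : d * (‖u‖ + ‖v‖ + 1) = 1 - ‖p‖ := div_mul_cancel₀ _ (by positivity)
  have hu := mul_nonneg hd.le (norm_nonneg u)
  have hv := mul_nonneg hd.le (norm_nonneg v)
  refine ⟨(d : ℂ), by exact_mod_cast hd.ne', ?_, ?_⟩
  · rw [mem_ball_zero_iff]
    have h1 := norm_add_le p ((d : ℂ) • u)
    rw [norm_smul, Complex.norm_real, Real.norm_of_nonneg hd.le] at h1
    linarith
  · rw [mem_ball_zero_iff]
    have h1 := norm_add_le p ((d : ℂ) • v)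
    rw [norm_smul, Complex.norm_real, Real.norm_of_nonneg hd.le] at h1
    linarith

/-- The set of directions fixed by `χ` at the fixed point `p`. -/
def fixDir (χ : E → E) (hd : DifferentiableOn ℂ χ (ball (0 : E) 1))
    (hm : MapsTo χ (ball (0 : E) 1) (ball (0 : E) 1))
    (p : E) (hp : p ∈ ball (0 : E) 1) (hpf : χ p = p) : Submodule ℂ E where
  carrier := {v | ∀ t : ℂ, p + t • v ∈ ball (0 : E) 1 → χ (p + t • v) = p + t • v}
  zero_mem' := by
    intro t _
    simpa using hpf
  smul_mem' := by
    intro c v hv t ht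
    rw [smul_smul] at ht ⊢
    exact hv _ ht
  add_mem' := by
    intro u v hu hv
    obtain ⟨d, hd0, hbu, hbv⟩ := near_ball hp u v
    have hM : (p + d • u) + (1 / 2 : ℂ) • (d • v - d • u) = p + (d / 2) • (u + v) := by
      module
    have hMb : p + (d / 2) • (u + v) ∈ ball (0 : E) 1 := by
      have e : p + (d / 2) • (u + v) = (1 / 2 : ℂ) • (p + d • u) + (1 / 2 : ℂ) • (p + d • v) := by
        module
      rw [e]
      rw [mem_ball_zero_iff] at hbu hbv ⊢
      have h1 := norm_add_le ((1 / 2 : ℂ) • (p + d • u)) ((1 / 2 : ℂ) • (p + d • v))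
      have h2 : ‖(1 / 2 : ℂ)‖ = 1 / 2 := by norm_num
      rw [norm_smul, norm_smul, h2] at h1
      linarith
    have hB : (p + d • u) + (d • v - d • u) = p + d • v := by abel
    have hMf := fix_line χ hd hm (p + d • u) (d • v - d • u) hbu (hu d hbu)
      (by rw [hB]; exact hbv) (by rw [hB]; exact hv d hbv) (1 / 2) (by rw [hM]; exact hMb)
    rw [hM] at hMf
    intro t ht
    have e : t • (u + v) = (t * (2 / d)) • ((d / 2) • (u + v)) := by
      rw [smul_smul]
      congr 1
      field_simp
    rw [e] at ht ⊢
    exact fix_line χ hd hm p _ hp hpf hMb hMf _ ht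

end helpers

theorem ballAut_comp {ι : Type} [Fintype ι] {ψ χ : EuclideanSpace ℂ ι → EuclideanSpace ℂ ι}
    (h₁ : IsBallAut ψ) (h₂ : IsBallAut χ) : IsBallAut (ψ ∘ χ) := by
  obtain ⟨d1, m1, φ1, e1, n1, l1, r1⟩ := h₁
  obtain ⟨d2, m2, φ2, e2, n2, l2, r2⟩ := h₂
  refine ⟨d1.comp d2 m2, m1.comp m2, φ2 ∘ φ1, e2.comp e1 n1, n2.comp n1, ?_, ?_⟩
  · intro z hz
    simp [l1 _ (m2 hz), l2 _ hz]
  · intro z hz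
    simp [r2 _ (n1 hz), r1 _ hz]

theorem aut_unique {n N : ℕ}
    (f : EuclideanSpace ℂ (Fin n) → EuclideanSpace ℂ (Fin N))
    (hfm : MapsTo f (ball (0 : EuclideanSpace ℂ (Fin n)) 1) (ball (0 : EuclideanSpace ℂ (Fin N)) 1))
    (hmin : ∀ s : AffineSubspace ℂ (EuclideanSpace ℂ (Fin N)),
      (∀ z ∈ ball (0 : EuclideanSpace ℂ (Fin n)) 1, f z ∈ s) → s = ⊤)
    (ψ χ : EuclideanSpace ℂ (Fin N) → EuclideanSpace ℂ (Fin N))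
    (hψ : IsBallAut ψ) (hχ : IsBallAut χ)
    (h : ∀ z ∈ ball (0 : EuclideanSpace ℂ (Fin n)) 1, ψ (f z) = χ (f z)) :
    ∀ w ∈ ball (0 : EuclideanSpace ℂ (Fin N)) 1, ψ w = χ w := by
  obtain ⟨d1, m1, -⟩ := hψ
  obtain ⟨d2, m2, φ, e2, n2, l2, r2⟩ := hχ
  have h0 : (0 : EuclideanSpace ℂ (Fin n)) ∈ ball (0 : EuclideanSpace ℂ (Fin n)) 1 := by simp
  have hfix : ∀ z ∈ ball (0 : EuclideanSpace ℂ (Fin n)) 1, (φ ∘ ψ) (f z) = f z := by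
    intro z hz
    rw [Function.comp_apply, h z hz, l2 _ (hfm hz)]
  have D := e2.comp d1 m1
  have M := n2.comp m1
  let V := fixDir (φ ∘ ψ) D M (f 0) (hfm h0) (hfix 0 h0)
  have htop := hmin (AffineSubspace.mk' (f 0) V) (by
    intro z hz
    rw [AffineSubspace.mem_mk', vsub_eq_sub]
    intro t ht
    exact fix_line _ D M _ _ (hfm h0) (hfix 0 h0) (by simpa using hfm hz)
      (by simpa using hfix z hz) t ht)
  intro w hw
  have hw' : w ∈ AffineSubspace.mk' (f 0) V := by rw [htop]; trivial
  rw [AffineSubspace.mem_mk', vsub_eq_sub] at hw'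
  have h1 := hw' 1 (by simpa using hw)
  simp only [one_smul, add_sub_cancel, Function.comp_apply] at h1
  rw [← r2 _ (m1 hw), h1]

/-- for a minimal holomorphic `f : 𝔹ⁿ → 𝔹ᴺ`, each `γ ∈ Γ_f` determines a unique
(on the ball) automorphism `ψ` with `f ∘ γ = ψ ∘ f`; the resulting map `Φ` is a homomorphism
(on the ball) and `f` is equivariant: `f (γ z) = Φ γ (f z)`. -/
theorem stmt7 {n N : ℕ}
    (f : EuclideanSpace ℂ (Fin n) → EuclideanSpace ℂ (Fin N))
    (hf : DifferentiableOn ℂ f (ball (0 : EuclideanSpace ℂ (Fin n)) 1))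
    (hfm : MapsTo f (ball (0 : EuclideanSpace ℂ (Fin n)) 1) (ball (0 : EuclideanSpace ℂ (Fin N)) 1))
    (hmin : ∀ s : AffineSubspace ℂ (EuclideanSpace ℂ (Fin N)),
      (∀ z ∈ ball (0 : EuclideanSpace ℂ (Fin n)) 1, f z ∈ s) → s = ⊤) :
    ∃ Φ : (EuclideanSpace ℂ (Fin n) → EuclideanSpace ℂ (Fin n)) →
        (EuclideanSpace ℂ (Fin N) → EuclideanSpace ℂ (Fin N)),
      (∀ γ, IsBallAut γ →
        (∃ ψ, IsBallAut ψ ∧ ∀ z ∈ ball (0 : EuclideanSpace ℂ (Fin n)) 1, f (γ z) = ψ (f z)) →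
          IsBallAut (Φ γ) ∧
          (∀ z ∈ ball (0 : EuclideanSpace ℂ (Fin n)) 1, f (γ z) = Φ γ (f z)) ∧
          (∀ ψ, IsBallAut ψ →
            (∀ z ∈ ball (0 : EuclideanSpace ℂ (Fin n)) 1, f (γ z) = ψ (f z)) →
            ∀ w ∈ ball (0 : EuclideanSpace ℂ (Fin N)) 1, ψ w = Φ γ w)) ∧
      (∀ γ₁ γ₂, IsBallAut γ₁ → IsBallAut γ₂ →
        (∃ ψ₁, IsBallAut ψ₁ ∧ ∀ z ∈ ball (0 : EuclideanSpace ℂ (Fin n)) 1, f (γ₁ z) = ψ₁ (f z)) →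
        (∃ ψ₂, IsBallAut ψ₂ ∧ ∀ z ∈ ball (0 : EuclideanSpace ℂ (Fin n)) 1, f (γ₂ z) = ψ₂ (f z)) →
        ∀ w ∈ ball (0 : EuclideanSpace ℂ (Fin N)) 1, Φ (γ₂ ∘ γ₁) w = Φ γ₂ (Φ γ₁ w)) := by
  classical
  let Q : (EuclideanSpace ℂ (Fin n) → EuclideanSpace ℂ (Fin n)) → Prop := fun γ =>
    ∃ ψ, IsBallAut ψ ∧ ∀ z ∈ ball (0 : EuclideanSpace ℂ (Fin n)) 1, f (γ z) = ψ (f z)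
  let Φ : (EuclideanSpace ℂ (Fin n) → EuclideanSpace ℂ (Fin n)) →
        (EuclideanSpace ℂ (Fin N) → EuclideanSpace ℂ (Fin N)) := fun γ =>
    if h : Q γ then h.choose else id
  have hΦ : ∀ γ, Q γ → IsBallAut (Φ γ) ∧
      ∀ z ∈ ball (0 : EuclideanSpace ℂ (Fin n)) 1, f (γ z) = Φ γ (f z) := by
    intro γ h
    simp only [Φ, dif_pos h]
    exact h.choose_spec
  refine ⟨Φ, ?_, ?_⟩
  · intro γ _ h
    obtain ⟨h1, h2⟩ := hΦ γ h
    refine ⟨h1, h2, ?_⟩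
    intro ψ hψ hz
    exact aut_unique f hfm hmin ψ (Φ γ) hψ h1 (fun z hb => by rw [← hz z hb, ← h2 z hb])
  · intro γ₁ γ₂ a1 _ q1 q2
    obtain ⟨h1, h1'⟩ := hΦ γ₁ q1
    obtain ⟨h2, h2'⟩ := hΦ γ₂ q2
    have hc := ballAut_comp h2 h1
    have hz : ∀ z ∈ ball (0 : EuclideanSpace ℂ (Fin n)) 1,
        f ((γ₂ ∘ γ₁) z) = (Φ γ₂ ∘ Φ γ₁) (f z) := by
      intro z hb
      simp only [Function.comp_apply]
      rw [h2' _ (a1.2.1 hb), h1' z hb]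
    obtain ⟨h3, h3'⟩ := hΦ (γ₂ ∘ γ₁) ⟨_, hc, hz⟩
    exact aut_unique f hfm hmin _ _ h3 hc (fun z hb => (h3' z hb).symm.trans (hz z hb))
end
end

section
/- Let f : 𝔹ⁿ → 𝔹ᴺ be a minimal proper holomorphic map and Φ : Γ_f → Aut(𝔹ᴺ) the induced homomorphism. Then Ker(Φ) = {γ ∈ Aut(𝔹ⁿ) : f ∘ γ = f} is a finite subgroup of Aut(𝔹ⁿ). -/
noncomputable section
open Metric Set

open Topology Filter in
/-- Local boundedness of the derivative. -/
lemma aux_fderiv_bound {E F : Type*} [NormedAddCommGroup E] [NormedSpace ℂ E]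
    [NormedAddCommGroup F] [NormedSpace ℂ F] {f : E → F} {U : Set E} (hU : IsOpen U)
    (hf : DifferentiableOn ℂ f U) {z₀ : E} (hz : z₀ ∈ U) :
    ∃ R > 0, ball z₀ (2 * R) ⊆ U ∧ ∃ C : ℝ, ∀ z ∈ ball z₀ R, ‖fderiv ℂ f z‖ ≤ C := by
  have hc : ContinuousAt f z₀ := (hf.continuousOn).continuousAt (hU.mem_nhds hz)
  have h1 : ∀ᶠ z in 𝓝 z₀, z ∈ U ∧ f z ∈ ball (f z₀) 1 :=
    (show ∀ᶠ z in 𝓝 z₀, z ∈ U from hU.mem_nhds hz).and (hc.eventually (ball_mem_nhds _ one_pos))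
  obtain ⟨ε, hε, h⟩ := Metric.eventually_nhds_iff_ball.1 h1
  refine ⟨ε / 2, by positivity, fun z hz => (h z (by convert hz using 2; ring)).1,
    2 / (ε / 2), fun z hz => ?_⟩
  have hsub : ball z (ε / 2) ⊆ ball z₀ ε := by
    apply ball_subset_ball'
    rw [mem_ball] at hz
    linarith
  apply Complex.norm_fderiv_le_div_of_mapsTo_ball
  · exact hf.mono fun w hw => (h w (hsub hw)).1
  · intro w hw
    have a := (h w (hsub hw)).2
    have b := (h z (hsub (mem_ball_self (by positivity)))).2
    rw [mem_ball] at a b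
    rw [mem_closedBall]
    linarith [dist_triangle_right (f w) (f z) (f z₀)]
  · positivity

open Topology Filter Complex in
lemma aux_fderiv_apply_diff {E F : Type*} [NormedAddCommGroup E] [NormedSpace ℂ E]
    [FiniteDimensional ℂ E]
    [NormedAddCommGroup F] [NormedSpace ℂ F] [FiniteDimensional ℂ F]
    {f : E → F} {U : Set E} (hU : IsOpen U)
    (hf : DifferentiableOn ℂ f U) {z₀ : E} (hz : z₀ ∈ U) (v : E) :
    DifferentiableAt ℂ (fun z => fderiv ℂ f z v) z₀ := by
  obtain ⟨R, hR, hRU, C, hC⟩ := aux_fderiv_bound hU hf hz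
  obtain ⟨r, hr, hrv⟩ : ∃ r > 0, r * ‖v‖ < R / 2 := by
    refine ⟨R / 2 / (‖v‖ + 1), by positivity, ?_⟩
    rw [div_mul_eq_mul_div, div_lt_iff₀ (by positivity)]
    nlinarith [norm_nonneg v]
  have hin : ∀ x ∈ ball z₀ (R / 2), ∀ ζ : ℂ, ‖ζ‖ ≤ r → x + ζ • v ∈ ball z₀ R := by
    intro x hx ζ hζ
    rw [mem_ball, dist_eq_norm] at *
    have : ‖x + ζ • v - z₀‖ ≤ ‖x - z₀‖ + ‖ζ • v‖ := by
      rw [show x + ζ • v - z₀ = (x - z₀) + ζ • v by abel]; exact norm_add_le _ _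
    rw [norm_smul] at this
    nlinarith [norm_nonneg v]
  have hRU' : ball z₀ R ⊆ U := (ball_subset_ball (by linarith)).trans hRU
  have hda : ∀ x ∈ ball z₀ R, DifferentiableAt ℂ f x := fun x hx =>
    hf.differentiableAt (hU.mem_nhds (hRU' hx))
  have hcm : ∀ θ, ‖circleMap 0 r θ‖ ≤ r := fun θ => by simp [abs_of_pos hr]
  let c : ℝ → ℂ := fun θ => deriv (circleMap 0 r) θ * (1 / (circleMap 0 r θ - 0) ^ 2)
  have hcc : Continuous c := by
    have : ∀ θ, circleMap 0 r θ - 0 ≠ 0 := fun θ => by simp [hr.ne']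
    simp only [c, deriv_circleMap]
    refine Continuous.mul (by fun_prop) (Continuous.div (by fun_prop) (by fun_prop) ?_)
    intro θ; exact pow_ne_zero _ (this θ)
  have key : ∀ x ∈ ball z₀ (R / 2),
      (2 * Real.pi * I : ℂ)⁻¹ • ∫ θ in (0:ℝ)..2 * Real.pi, c θ • f (x + circleMap 0 r θ • v)
        = fderiv ℂ f x v := by
    intro x hx
    have hd : DifferentiableOn ℂ (fun ζ : ℂ => f (x + ζ • v)) (closedBall 0 r) := by
      intro ζ hζ
      apply DifferentiableAt.differentiableWithinAt
      have := hda _ (hin x hx ζ (by simpa using hζ))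
      exact DifferentiableAt.comp (f := fun ζ : ℂ => x + ζ • v) ζ this (by fun_prop)
    have h1 := hd.deriv_eq_smul_circleIntegral hr
    have h2 : deriv (fun ζ : ℂ => f (x + ζ • v)) 0 = fderiv ℂ f x v := by
      have ha : HasDerivAt (fun ζ : ℂ => x + ζ • v) v 0 := by
        simpa using ((hasDerivAt_id (0:ℂ)).smul_const v).const_add x
      have hb : HasFDerivAt f (fderiv ℂ f x) (x + (0:ℂ) • v) := by
        have := (hda x (ball_subset_ball (by linarith) hx)).hasFDerivAt
        simpa using this
      exact (hb.comp_hasDerivAt (0:ℂ) ha).deriv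
    rw [h2] at h1
    rw [inv_smul_eq_iff₀ (by simp [Real.pi_ne_zero]), ← h1, circleIntegral]
    simp only [c, smul_smul]
  have hcont : ∀ x ∈ ball z₀ (R / 2), Continuous fun θ => c θ • f (x + circleMap 0 r θ • v) := by
    intro x hx
    refine hcc.smul ?_
    rw [continuous_iff_continuousAt]
    intro θ
    have h1 := (hda _ (hin x hx _ (hcm θ))).continuousAt
    exact ContinuousAt.comp (f := fun θ => x + circleMap 0 r θ • v) h1 (by fun_prop)
  have hnear : ball z₀ (R / 2) ∈ 𝓝 z₀ := ball_mem_nhds _ (by positivity)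
  have hI : HasFDerivAt (fun x => ∫ θ in (0:ℝ)..2 * Real.pi, c θ • f (x + circleMap 0 r θ • v))
      (∫ θ in (0:ℝ)..2 * Real.pi, c θ • fderiv ℂ f (z₀ + circleMap 0 r θ • v)) z₀ := by
    refine intervalIntegral.hasFDerivAt_integral_of_dominated_of_fderiv_le
      (F := fun x θ => c θ • f (x + circleMap 0 r θ • v))
      (F' := fun x θ => c θ • fderiv ℂ f (x + circleMap 0 r θ • v))
      (bound := fun θ => ‖c θ‖ * C) hnear ?_ ?_ ?_ ?_ ?_ ?_
    · filter_upwards [hnear] with x hx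
      exact (hcont x hx).aestronglyMeasurable
    · exact (hcont z₀ (mem_of_mem_nhds hnear)).intervalIntegrable _ _
    · borelize E
      have : FiniteDimensional ℂ (E →L[ℂ] F) := inferInstance
      have : ProperSpace (E →L[ℂ] F) := FiniteDimensional.proper ℂ _
      have : SecondCountableTopology (E →L[ℂ] F) := inferInstance
      have : CompleteSpace F := FiniteDimensional.complete ℂ F
      have : ProperSpace E := FiniteDimensional.proper ℂ _
      borelize (E →L[ℂ] F)
      refine hcc.aestronglyMeasurable.smul ?_
      apply Measurable.aestronglyMeasurable
      exact (measurable_fderiv ℂ f).comp (Continuous.measurable (by fun_prop))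
    · refine Eventually.of_forall fun θ _ x hx => ?_
      rw [norm_smul]
      exact mul_le_mul_of_nonneg_left (hC _ (hin x hx _ (hcm θ))) (norm_nonneg _)
    · exact (hcc.norm.mul continuous_const).intervalIntegrable _ _
    · refine Eventually.of_forall fun θ _ x hx => ?_
      have h1 := (hda _ (hin x hx _ (hcm θ))).hasFDerivAt
      have h2 : HasFDerivAt (fun x => f (x + circleMap 0 r θ • v))
          (fderiv ℂ f (x + circleMap 0 r θ • v)) x := by
        have h3 := HasFDerivAt.comp (f := fun x => x + circleMap 0 r θ • v) x h1
          ((hasFDerivAt_id x).add_const (circleMap 0 r θ • v))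
        rwa [ContinuousLinearMap.comp_id] at h3
      exact h2.const_smul (c θ)
  refine (hI.const_smul ((2 * Real.pi * I : ℂ)⁻¹)).differentiableAt.congr_of_eventuallyEq ?_
  filter_upwards [hnear] with x hx
  exact (key x hx).symm

open Topology Filter in
lemma aux_contDiffAt {E F : Type*} [NormedAddCommGroup E] [NormedSpace ℂ E]
    [FiniteDimensional ℂ E]
    [NormedAddCommGroup F] [NormedSpace ℂ F] [FiniteDimensional ℂ F]
    {f : E → F} {U : Set E} (hU : IsOpen U)
    (hf : DifferentiableOn ℂ f U) {z₀ : E} (hz : z₀ ∈ U) :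
    ContDiffAt ℂ 1 f z₀ := by
  rw [contDiffAt_one_iff]
  refine ⟨fderiv ℂ f, U, hU.mem_nhds hz, continuousOn_clm_apply.2 fun v z hz => ?_,
    fun x hx => (hf.differentiableAt (hU.mem_nhds hx)).hasFDerivAt⟩
  exact (aux_fderiv_apply_diff hU hf hz v).continuousAt.continuousWithinAt

open Topology Filter in
/-- A proper holomorphic map (compact fibres suffice) is an immersion somewhere. -/
lemma aux_exists_immersion {E F : Type*} [NormedAddCommGroup E] [InnerProductSpace ℂ E]
    [FiniteDimensional ℂ E]
    [NormedAddCommGroup F] [NormedSpace ℂ F] [FiniteDimensional ℂ F]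
    {f : E → F} {U : Set E} (hU : IsOpen U) (hne : U.Nonempty)
    (hf : DifferentiableOn ℂ f U)
    (hK : ∀ q, IsCompact (U ∩ f ⁻¹' {q})) :
    ∃ p ∈ U, Function.Injective (fderiv ℂ f p) := by
  by_contra hcon
  push Not at hcon
  have : CompleteSpace E := FiniteDimensional.complete ℂ E
  -- a point of maximal rank
  let rk : E → ℕ := fun z => Module.finrank ℂ (LinearMap.range (fderiv ℂ f z : E →ₗ[ℂ] F))
  obtain ⟨p, hpU, hpmax⟩ : ∃ p ∈ U, ∀ z ∈ U, rk z ≤ rk p := by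
    have hfin : (rk '' U).Finite := (Set.finite_Iic (Module.finrank ℂ F)).subset (by
      rintro _ ⟨z, -, rfl⟩
      exact Submodule.finrank_le _)
    obtain ⟨_, ⟨p, hp, rfl⟩, h⟩ := Set.exists_max_image (rk '' U) id hfin (hne.image _)
    exact ⟨p, hp, fun z hz => h _ ⟨z, hz, rfl⟩⟩
  let V := LinearMap.range (fderiv ℂ f p : E →ₗ[ℂ] F)
  obtain ⟨S, hS⟩ := (fderiv ℂ f p : E →ₗ[ℂ] F).rangeRestrict.exists_rightInverse_of_surjective
    (LinearMap.range_rangeRestrict _)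
  obtain ⟨P, hP⟩ := V.subtype.exists_leftInverse_of_injective (Submodule.ker_subtype V)
  let T : E → (V →ₗ[ℂ] V) := fun z => P ∘ₗ (fderiv ℂ f z : E →ₗ[ℂ] F) ∘ₗ S
  have hTp : T p = LinearMap.id := by
    ext x
    have h1 : (fderiv ℂ f p) (S x) = (x : F) := by
      have := congrArg (fun L => ((L x : V) : F)) hS
      simpa using this
    have h2 := LinearMap.congr_fun hP x
    simp only [LinearMap.comp_apply, Submodule.subtype_apply, LinearMap.id_apply] at h2
    simp only [T, LinearMap.comp_apply, ContinuousLinearMap.coe_coe, h1, h2, LinearMap.id_apply]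
  let Δ : E → ℂ := fun z => LinearMap.det (T z)
  have hΔp : Δ p = 1 := by simp [Δ, hTp]
  have hΔd : ∀ z ∈ U, DifferentiableAt ℂ Δ z := by
    intro z hz
    let b := Module.finBasis ℂ V
    have h1 : Δ = fun z => Matrix.det (LinearMap.toMatrix b b (T z)) := by
      funext z; simp [Δ]
    rw [h1]
    simp only [Matrix.det_apply]
    have h2 : ∀ i j, DifferentiableAt ℂ (fun z => LinearMap.toMatrix b b (T z) i j) z := by
      intro i j
      simp only [LinearMap.toMatrix_apply, T, LinearMap.comp_apply, ContinuousLinearMap.coe_coe]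
      let L : F →L[ℂ] ℂ := LinearMap.toContinuousLinearMap ((b.coord i) ∘ₗ P)
      exact L.differentiableAt.comp z (aux_fderiv_apply_diff hU hf hz (S (b j)))
    refine DifferentiableAt.fun_sum fun σ _ => ?_
    refine DifferentiableAt.const_smul ?_ _
    exact (HasFDerivAt.finsetProd fun i _ => (h2 (σ i) i).hasFDerivAt).differentiableAt
  -- kernel of `P ∘ Df` equals the kernel of `Df` where `Δ ≠ 0`
  have hker : ∀ z ∈ U, Δ z ≠ 0 → ∀ x, P (fderiv ℂ f z x) = 0 → fderiv ℂ f z x = 0 := by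
    intro z hz hΔ x hx
    let W := LinearMap.range (fderiv ℂ f z : E →ₗ[ℂ] F)
    let Q : W →ₗ[ℂ] V := P ∘ₗ W.subtype
    have hQs : Function.Surjective Q := by
      intro y
      obtain ⟨x, hx⟩ := (LinearEquiv.ofIsUnitDet (f := T z) (v := Module.finBasis ℂ V)
        (v' := Module.finBasis ℂ V) (by
          rw [LinearMap.det_toMatrix]; exact isUnit_iff_ne_zero.2 hΔ)).surjective y
      exact ⟨⟨fderiv ℂ f z (S x), ⟨S x, rfl⟩⟩, hx⟩
    have hle : Module.finrank ℂ W ≤ Module.finrank ℂ V := hpmax z hz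
    have hge := LinearMap.finrank_le_finrank_of_surjective hQs
    have hQi := (LinearMap.injective_iff_surjective_of_finrank_eq_finrank
      (le_antisymm hle hge)).2 hQs
    have h0 : (⟨fderiv ℂ f z x, ⟨x, rfl⟩⟩ : W) = 0 := hQi (by
      rw [map_zero]; exact hx)
    exact congrArg Subtype.val h0
  -- the maximum point
  obtain ⟨z₀, ⟨hz₀U, hz₀f⟩, hmax⟩ := (hK (f p)).exists_isMaxOn ⟨p, hpU, rfl⟩
    (f := fun z => ‖Δ z‖ * Real.exp (‖z‖ ^ 2)) (by
      intro z hz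
      apply ContinuousAt.continuousWithinAt
      have := (hΔd z hz.1).continuousAt
      fun_prop)
  have hΔ0 : Δ z₀ ≠ 0 := by
    intro h0
    have := hmax (show p ∈ U ∩ f ⁻¹' {f p} from ⟨hpU, rfl⟩)
    simp only [mem_ofPred_eq, h0, hΔp, norm_zero, norm_one, zero_mul, one_mul] at this
    exact absurd this (not_le.2 (Real.exp_pos _))
  set D := fderiv ℂ f z₀ with hD
  obtain ⟨v, hv0, hvD⟩ : ∃ v, v ≠ 0 ∧ D v = 0 := by
    have := hcon z₀ hz₀U
    rw [injective_iff_map_eq_zero] at this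
    push Not at this
    obtain ⟨v, h1, h2⟩ := this
    exact ⟨v, h2, h1⟩
  let A : V ≃ₗ[ℂ] V := LinearEquiv.ofIsUnitDet (f := T z₀) (v := Module.finBasis ℂ V)
        (v' := Module.finBasis ℂ V) (by
          rw [LinearMap.det_toMatrix]; exact isUnit_iff_ne_zero.2 hΔ0)
  have hA : ∀ y, P (D (S (A.symm y))) = y := fun y => A.apply_symm_apply y
  let Pc : F →L[ℂ] V := LinearMap.toContinuousLinearMap P
  let B : V →L[ℂ] E := LinearMap.toContinuousLinearMap (S ∘ₗ (A.symm : V →ₗ[ℂ] V))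
  let Ψ : E → E := fun z => z + B (Pc (f z) - Pc (D z))
  have hPΨ : ∀ z, P (D (Ψ z)) = P (f z) := by
    intro z
    simp only [Ψ, map_add]
    have : P (D (B (Pc (f z) - Pc (D z)))) = Pc (f z) - Pc (D z) := hA _
    rw [this]
    simp [Pc]
  have hfz₀ : HasFDerivAt f D z₀ := (hf.differentiableAt (hU.mem_nhds hz₀U)).hasFDerivAt
  have hΨd : HasFDerivAt Ψ ((ContinuousLinearEquiv.refl ℂ E : E ≃L[ℂ] E) : E →L[ℂ] E) z₀ := by
    have h1 : HasFDerivAt (fun z => Pc (f z) - Pc (D z)) (Pc.comp D - Pc.comp D) z₀ :=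
      (Pc.hasFDerivAt.comp z₀ hfz₀).sub ((Pc.comp D).hasFDerivAt)
    have h2 := (hasFDerivAt_id z₀).add (B.hasFDerivAt.comp z₀ h1)
    rw [sub_self, ContinuousLinearMap.comp_zero, add_zero] at h2
    exact h2
  have hΨc : ContDiffAt ℂ 1 Ψ z₀ := by
    have := aux_contDiffAt hU hf hz₀U
    fun_prop
  let θ := hΨc.localInverse hΨd one_ne_zero
  have hθ0 : θ (Ψ z₀) = z₀ := hΨc.localInverse_apply_image hΨd one_ne_zero
  have hθc : ContDiffAt ℂ 1 θ (Ψ z₀) := hΨc.to_localInverse hΨd one_ne_zero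
  have hθr : ∀ᶠ y in 𝓝 (Ψ z₀), Ψ (θ y) = y :=
    (hΨc.hasStrictFDerivAt' hΨd one_ne_zero).eventually_right_inverse
  let φ : ℂ → E := fun t => θ (Ψ z₀ + t • v)
  have hφ0 : φ 0 = z₀ := by simp [φ, hθ0]
  have hline : Tendsto (fun t : ℂ => Ψ z₀ + t • v) (𝓝 0) (𝓝 (Ψ z₀)) := by
    have : Continuous (fun t : ℂ => Ψ z₀ + t • v) := by fun_prop
    simpa using this.tendsto 0
  have hφd : ∀ᶠ t in 𝓝 (0:ℂ), DifferentiableAt ℂ φ t := by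
    have h1 := (hθc.eventually (by simp)).mono fun y hy => hy.differentiableAt one_ne_zero
    filter_upwards [hline.eventually h1] with t ht
    exact DifferentiableAt.comp (f := fun t : ℂ => Ψ z₀ + t • v) t ht (by fun_prop)
  have hφΨ : ∀ᶠ t in 𝓝 (0:ℂ), Ψ (φ t) = Ψ z₀ + t • v := hline.eventually hθr
  have hφc : ContinuousAt φ 0 := hφd.self_of_nhds.continuousAt
  have hφU : ∀ᶠ t in 𝓝 (0:ℂ), φ t ∈ U := hφc.eventually (by
    rw [hφ0]; exact hU.mem_nhds hz₀U)
  have hφΔ : ∀ᶠ t in 𝓝 (0:ℂ), Δ (φ t) ≠ 0 := hφc.eventually (by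
    rw [hφ0]; exact (hΔd z₀ hz₀U).continuousAt.eventually_ne hΔ0)
  -- `f ∘ φ` is locally constant
  have hfφ : ∀ᶠ t in 𝓝 (0:ℂ), f (φ t) = f z₀ := by
    obtain ⟨ε, hε, h⟩ := Metric.eventually_nhds_iff_ball.1
      (hφd.and (hφΨ.and (hφU.and hφΔ)))
    have hd : DifferentiableOn ℂ (f ∘ φ) (ball 0 ε) := fun t ht =>
      ((hf.differentiableAt (hU.mem_nhds (h t ht).2.2.1)).comp t
        (h t ht).1).differentiableWithinAt
    have hPc : ∀ t ∈ ball (0:ℂ) ε, P (f (φ t)) = P (f z₀) := by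
      intro t ht
      rw [← hPΨ, (h t ht).2.1, map_add, map_smul, hvD, smul_zero, add_zero, hPΨ]
    have hz : ∀ t ∈ ball (0:ℂ) ε, deriv (f ∘ φ) t = 0 := by
      intro t ht
      have e1 : HasDerivAt (f ∘ φ) (fderiv ℂ f (φ t) (deriv φ t)) t :=
        (hf.differentiableAt (hU.mem_nhds (h t ht).2.2.1)).hasFDerivAt.comp_hasDerivAt t
          (h t ht).1.hasDerivAt
      have e2 : HasDerivAt (fun t => Pc (f (φ t))) (Pc (fderiv ℂ f (φ t) (deriv φ t))) t :=
        Pc.hasFDerivAt.comp_hasDerivAt t e1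
      have e3 : HasDerivAt (fun t => Pc (f (φ t))) 0 t := by
        refine (hasDerivAt_const t (Pc (f z₀))).congr_of_eventuallyEq ?_
        filter_upwards [isOpen_ball.mem_nhds ht] with s hs
        exact hPc s hs
      rw [e1.deriv]
      exact hker _ (h t ht).2.2.1 (h t ht).2.2.2 _ (e2.unique e3)
    filter_upwards [ball_mem_nhds (0:ℂ) hε] with t ht
    have := isOpen_ball.is_const_of_deriv_eq_zero (convex_ball (0:ℂ) ε).isPreconnected hd
      hz ht (mem_ball_self hε)
    simpa [hφ0] using this
  -- maximum principle
  let G : ℂ → ℂ := fun t => Δ (φ t) * Complex.exp (2 * inner ℂ z₀ (φ t))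
  have hGd : ∀ᶠ t in 𝓝 (0:ℂ), DifferentiableAt ℂ G t := by
    filter_upwards [hφd, hφU] with t h1 h2
    have h3 : DifferentiableAt ℂ (fun t => Δ (φ t)) t := (hΔd _ h2).comp t h1
    have h4 : DifferentiableAt ℂ (fun t => inner ℂ z₀ (φ t)) t :=
      (innerSL ℂ z₀).differentiableAt.comp t h1
    exact h3.mul ((h4.const_mul 2).cexp)
  have hGn : ∀ t, ‖G t‖ = ‖Δ (φ t)‖ * Real.exp (‖φ t‖ ^ 2) *
      (Real.exp (‖z₀‖ ^ 2) * Real.exp (-‖φ t - z₀‖ ^ 2)) := by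
    intro t
    have h1 := norm_sub_sq (𝕜 := ℂ) z₀ (φ t)
    rw [norm_sub_rev] at h1
    simp only [G, norm_mul, Complex.norm_exp]
    rw [mul_assoc, ← Real.exp_add, ← Real.exp_add]
    congr 2
    have h2 : (2 * inner ℂ z₀ (φ t)).re = 2 * RCLike.re (inner ℂ z₀ (φ t)) := by
      simp
    rw [h2, h1]
    ring
  have hGle : ∀ᶠ t in 𝓝 (0:ℂ), ‖G t‖ ≤ ‖G 0‖ * Real.exp (-‖φ t - z₀‖ ^ 2) := by
    filter_upwards [hφU, hfφ] with t h1 h2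
    have h3 := hmax (show φ t ∈ U ∩ f ⁻¹' {f p} from ⟨h1, by
      rw [mem_preimage, h2]; exact hz₀f⟩)
    simp only [mem_ofPred_eq] at h3
    rw [hGn t, hGn 0, hφ0]
    simp only [sub_self, norm_zero, ne_eq, OfNat.ofNat_ne_zero, not_false_eq_true, zero_pow,
      neg_zero, Real.exp_zero, mul_one]
    rw [← mul_assoc]
    gcongr
  have hG0 : 0 < ‖G 0‖ := by
    rw [norm_pos_iff]
    exact mul_ne_zero (by rwa [hφ0]) (Complex.exp_ne_zero _)
  have hloc : IsLocalMax (norm ∘ G) 0 := by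
    filter_upwards [hGle] with t ht
    refine ht.trans (mul_le_of_le_one_right hG0.le ?_)
    rw [Real.exp_le_one_iff]
    nlinarith [sq_nonneg ‖φ t - z₀‖]
  have hconst := Complex.eventually_eq_of_isLocalMax_norm hGd hloc
  have hfinal : ∀ᶠ t in 𝓝 (0:ℂ), t = 0 := by
    filter_upwards [hconst, hGle, hφΨ] with t h1 h2 h3
    rw [h1] at h2
    have h4 : 1 ≤ Real.exp (-‖φ t - z₀‖ ^ 2) := by
      by_contra hlt
      push Not at hlt
      nlinarith
    rw [Real.one_le_exp_iff] at h4
    have h5 : ‖φ t - z₀‖ = 0 := by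
      have := sq_nonneg ‖φ t - z₀‖
      exact pow_eq_zero_iff (two_ne_zero) |>.1 (by linarith)
    have h6 : φ t = z₀ := sub_eq_zero.1 (norm_eq_zero.1 h5)
    rw [h6] at h3
    have h7 : t • v = 0 := by simpa using h3
    exact (smul_eq_zero.1 h7).resolve_right hv0
  obtain ⟨ε, hε, h⟩ := Metric.eventually_nhds_iff_ball.1 hfinal
  have := h ((ε / 2 : ℝ) : ℂ) (by
    rw [mem_ball, dist_zero_right, Complex.norm_real, Real.norm_of_nonneg (by positivity)]
    linarith)
  rw [Complex.ofReal_eq_zero] at this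
  linarith


open Topology Filter in
/-- A holomorphic self-map of the ball fixing `p`, compatible with an `f` injective near `p`,
is the identity. -/
lemma aux_unique {E F : Type*} [NormedAddCommGroup E] [NormedSpace ℂ E] [CompleteSpace E]
    {f : E → F} {p : E} {W : Set E} (hW : W ∈ 𝓝 p) (hinj : InjOn f W)
    {U : Set E} (hU : IsOpen U) (hconv : Convex ℝ U) (hp : p ∈ U) {g : E → E}
    (hg : DifferentiableOn ℂ g U) (hfg : ∀ z ∈ U, f (g z) = f z) (hgp : g p = p) :
    ∀ z ∈ U, g z = z := by
  have hgc : ContinuousAt g p := hg.continuousOn.continuousAt (hU.mem_nhds hp)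
  have hnear : ∀ᶠ z in 𝓝 p, g z = z := by
    have h1 : ∀ᶠ z in 𝓝 p, g z ∈ W := hgc.eventually (by rw [hgp]; exact hW)
    have h2 : ∀ᶠ z in 𝓝 p, z ∈ U := hU.mem_nhds hp
    have h3 : ∀ᶠ z in 𝓝 p, z ∈ W := hW
    filter_upwards [h1, h2, h3] with z h1 h2 h3
    exact hinj h1 h3 (hfg z h2)
  intro z hz
  let l : ℂ → E := fun t => p + t • (z - p)
  have hlc : Continuous l := by fun_prop
  have hld : Differentiable ℂ l := by fun_prop
  let O : Set ℂ := l ⁻¹' U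
  have hO : IsOpen O := hU.preimage hlc
  have hOc : Convex ℝ O := by
    intro x hx y hy a b ha hb hab
    have := hconv hx hy ha hb hab
    have e : l (a • x + b • y) = a • l x + b • l y := by
      have hab' : (b : ℂ) = 1 - a := by
        rw [← Complex.ofReal_one, ← hab]; push_cast; ring
      simp only [l, ← Complex.coe_smul (E := E), Complex.real_smul, hab']
      module
    change l (a • x + b • y) ∈ U
    rw [e]; exact this
  have h0 : (0:ℂ) ∈ O := by simpa [O, l] using hp
  have h1 : (1:ℂ) ∈ O := by simpa [O, l] using hz
  have hA : AnalyticOnNhd ℂ (fun t => g (l t)) O :=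
    DifferentiableOn.analyticOnNhd
      (hg.comp hld.differentiableOn (fun t ht => ht)) hO
  have hB : AnalyticOnNhd ℂ l O := hld.differentiableOn.analyticOnNhd hO
  have hev : (fun t => g (l t)) =ᶠ[𝓝 0] l := by
    have : Tendsto l (𝓝 0) (𝓝 p) := by
      have := hlc.tendsto 0
      simpa [l] using this
    exact this.eventually hnear
  have := hA.eqOn_of_preconnected_of_eventuallyEq hB hOc.isPreconnected h0 hev h1
  simpa [l] using this

open Topology in
/-- Injective derivative gives local injectivity. -/
lemma aux_locInj {E F : Type*} [NormedAddCommGroup E] [NormedSpace ℂ E] [FiniteDimensional ℂ E]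
    [NormedAddCommGroup F] [NormedSpace ℂ F] [FiniteDimensional ℂ F]
    {f : E → F} {U : Set E} (hU : IsOpen U) (hf : DifferentiableOn ℂ f U)
    {p : E} (hp : p ∈ U) (hinj : Function.Injective (fderiv ℂ f p)) :
    ∃ W ∈ 𝓝 p, InjOn f W := by
  have : CompleteSpace E := FiniteDimensional.complete ℂ E
  obtain ⟨L, hL⟩ := (fderiv ℂ f p : E →ₗ[ℂ] F).exists_leftInverse_of_injective
    (LinearMap.ker_eq_bot.2 hinj)
  let Lc : F →L[ℂ] E := LinearMap.toContinuousLinearMap L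
  have h1 : HasStrictFDerivAt f (fderiv ℂ f p) p :=
    (aux_contDiffAt hU hf hp).hasStrictFDerivAt one_ne_zero
  have h2 := Lc.hasStrictFDerivAt.comp p h1
  have h3 : Lc.comp (fderiv ℂ f p) =
      ((ContinuousLinearEquiv.refl ℂ E : E ≃L[ℂ] E) : E →L[ℂ] E) := by
    ext x
    exact LinearMap.congr_fun hL x
  rw [h3] at h2
  let H := h2.toOpenPartialHomeomorph _
  refine ⟨H.source, H.open_source.mem_nhds h2.mem_toOpenPartialHomeomorph_source, ?_⟩
  intro x hx y hy hxy
  refine H.injOn hx hy ?_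
  change Lc (f x) = Lc (f y)
  rw [hxy]

/-- for a minimal proper holomorphic `f : 𝔹ⁿ → 𝔹ᴺ`, the kernel of the induced
homomorphism `Φ`, i.e. `{γ ∈ Aut(𝔹ⁿ) : f ∘ γ = f}`, is finite. Since automorphisms in our
model are determined only by their values on the ball, finiteness is stated for the set of
restrictions to the ball. -/
theorem stmt9 {n N : ℕ}
    (f : EuclideanSpace ℂ (Fin n) → EuclideanSpace ℂ (Fin N))
    (hf : DifferentiableOn ℂ f (ball (0 : EuclideanSpace ℂ (Fin n)) 1))
    (hfm : MapsTo f (ball (0 : EuclideanSpace ℂ (Fin n)) 1) (ball (0 : EuclideanSpace ℂ (Fin N)) 1))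
    (hmin : ∀ s : AffineSubspace ℂ (EuclideanSpace ℂ (Fin N)),
      (∀ z ∈ ball (0 : EuclideanSpace ℂ (Fin n)) 1, f z ∈ s) → s = ⊤)
    (hproper : ∀ K : Set (EuclideanSpace ℂ (Fin N)),
      K ⊆ ball (0 : EuclideanSpace ℂ (Fin N)) 1 → IsCompact K →
      IsCompact (ball (0 : EuclideanSpace ℂ (Fin n)) 1 ∩ f ⁻¹' K)) :
    Set.Finite ((fun γ : EuclideanSpace ℂ (Fin n) → EuclideanSpace ℂ (Fin n) =>
        (ball (0 : EuclideanSpace ℂ (Fin n)) 1).restrict γ) ''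
      {γ | IsBallAut γ ∧ ∀ z ∈ ball (0 : EuclideanSpace ℂ (Fin n)) 1, f (γ z) = f z}) := by
  set U := ball (0 : EuclideanSpace ℂ (Fin n)) 1 with hUdef
  have hU : IsOpen U := isOpen_ball
  have hfib : ∀ q, IsCompact (U ∩ f ⁻¹' {q}) := by
    intro q
    by_cases hq : q ∈ ball (0 : EuclideanSpace ℂ (Fin N)) 1
    · exact hproper {q} (by simpa using hq) isCompact_singleton
    · convert isCompact_empty
      ext z
      simp only [mem_inter_iff, mem_preimage, mem_singleton_iff, mem_empty_iff_false, iff_false]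
      rintro ⟨h1, rfl⟩
      exact hq (hfm h1)
  obtain ⟨p, hp, hpinj⟩ := aux_exists_immersion hU ⟨0, mem_ball_self one_pos⟩ hf hfib
  obtain ⟨W, hW, hWinj⟩ := aux_locInj hU hf hp hpinj
  -- key: two elements agreeing at `p` agree on the ball
  have huniq : ∀ γ δ : EuclideanSpace ℂ (Fin n) → EuclideanSpace ℂ (Fin n),
      (IsBallAut γ ∧ ∀ z ∈ U, f (γ z) = f z) → (IsBallAut δ ∧ ∀ z ∈ U, f (δ z) = f z) →
      γ p = δ p → ∀ z ∈ U, γ z = δ z := by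
    rintro γ δ ⟨⟨hγd, hγm, -⟩, hγf⟩ ⟨⟨hδd, hδm, φ, hφd, hφm, hφδ, hδφ⟩, hδf⟩ hpe z hz
    have hφf : ∀ z ∈ U, f (φ z) = f z := fun z hz => by
      rw [← hδf (φ z) (hφm hz), hδφ z hz]
    have h := aux_unique hW hWinj hU (convex_ball _ _) hp (g := φ ∘ γ) (hφd.comp hγd hγm)
      (fun z hz => by
        change f (φ (γ z)) = f z
        rw [hφf _ (hγm hz), hγf z hz])
      (by change φ (γ p) = p
          rw [hpe, hφδ p hp]) z hz
    change φ (γ z) = z at h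
    rw [← hδφ (γ z) (hγm hz), h]
  let e : (U → EuclideanSpace ℂ (Fin n)) → EuclideanSpace ℂ (Fin n) := fun h => h ⟨p, hp⟩
  refine Set.Finite.of_finite_image (f := e) ?_ ?_
  · -- the orbit of `p` is finite
    by_contra hinf
    obtain ⟨q, hq, hacc⟩ := Set.Infinite.exists_accPt_of_subset_isCompact hinf (hfib (f p)) (by
      rintro _ ⟨_, ⟨γ, ⟨hγ, hγf⟩, rfl⟩, rfl⟩
      exact ⟨hγ.2.1 hp, hγf p hp⟩)
    obtain ⟨ρ, hρ, hρW⟩ := Metric.mem_nhds_iff.1 hW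
    obtain ⟨d, hd, hdU⟩ := Metric.isOpen_iff.1 hU q hq.1
    -- two distinct orbit points near `q`
    let η := min (d / 4) (ρ * d / 16)
    have hη : 0 < η := by positivity
    have hη1 : η ≤ d / 4 := min_le_left _ _
    have hη2 : η ≤ ρ * d / 16 := min_le_right _ _
    have hfreq := accPt_iff_nhds.1 hacc
    obtain ⟨x, ⟨hx1, hx2⟩, hxq⟩ := hfreq (ball q η) (ball_mem_nhds _ hη)
    obtain ⟨y, ⟨hy1, hy2⟩, hyq⟩ := hfreq (ball q (dist x q)) (ball_mem_nhds _ (dist_pos.2 hxq))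
    have hxy : x ≠ y := by
      rintro rfl
      simp at hy1
    obtain ⟨_, ⟨γ, hγ, rfl⟩, hγx⟩ := hx2
    obtain ⟨_, ⟨δ, hδ, rfl⟩, hδy⟩ := hy2
    change γ p = x at hγx
    change δ p = y at hδy
    obtain ⟨⟨hγd, hγm, φ, hφd, hφm, hφγ, hγφ⟩, hγf⟩ := hγ
    obtain ⟨⟨hδd, hδm, -⟩, hδf⟩ := hδ
    rw [mem_ball] at hx1 hy1
    have hdist : dist y x < 2 * η := by
      linarith [dist_triangle_right y x q]
    have hsub : ball x (d / 2) ⊆ U := by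
      refine (ball_subset_ball' ?_).trans hdU
      linarith
    have hxU : x ∈ U := hsub (mem_ball_self (by positivity))
    have hyx : y ∈ ball x (d / 2) := by
      rw [mem_ball]; linarith
    have hS : dist (φ y) (φ x) ≤ 2 / (d / 2) * dist y x := by
      refine Complex.dist_le_div_mul_dist_of_mapsTo_ball (hφd.mono hsub) ?_ hyx
      intro w hw
      have h1 := hφm (hsub hw)
      have h2 := hφm hxU
      rw [mem_ball] at h1 h2
      rw [mem_closedBall]
      linarith [dist_triangle_right (φ w) (φ x) 0]
    have hφx : φ x = p := by rw [← hγx, hφγ p hp]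
    have hlt : dist (φ y) p < ρ := by
      rw [← hφx]
      refine hS.trans_lt ?_
      rw [div_mul_eq_mul_div, div_lt_iff₀ (by positivity)]
      have : 0 < ρ * d := by positivity
      linarith
    have hyU := hsub hyx
    have hfy : f (φ y) = f p := by
      rw [← hγf (φ y) (hφm hyU), hγφ y hyU, ← hδy, hδf p hp]
    have heq : φ y = p := hWinj (hρW hlt) (mem_of_mem_nhds hW) hfy
    apply hxy
    rw [← hγx, ← heq, hγφ y hyU]
  · rintro _ ⟨γ, hγ, rfl⟩ _ ⟨δ, hδ, rfl⟩ h
    funext z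
    exact huniq γ δ hγ hδ h z z.2
end
end
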